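/- Assume G ≅ C_{n1} ⊕ … ⊕ C_{nr} with 1 < n1 | … | nr and D(G) ≥ 4, and let G' be a finite abelian group with 𝓛(G) = 𝓛(G'). If r ≥ nr − 1 and n1 ≠ 2, then r(G) = r(G') and r(G') ≥ exp(G') − 1. -/

import Mathlib

/- Common definitions: zero-sum sequences over a finite abelian group,
   sets of lengths, the system of sets of lengths, the Davenport constant,
   sets of distances, elasticities, AAPs, Δ₁(G), ρ(G,d,k), ρ(G,d), ρ*(G,d),
   cross numbers, K(G₀), K(G,d), LCN-sets, Δ*(G). -/

open scoped Classical

section Defs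

variable {G : Type*} [AddCommGroup G]

/-- The support of a sequence (multiset) over `G`. -/
def suppSet (A : Multiset G) : Set G := {g | g ∈ A}

/-- `A` is a minimal zero-sum sequence (an atom of `𝓑(G₀)`) over `G₀ ⊆ G`:
a nontrivial zero-sum sequence with terms in `G₀` such that every proper
nontrivial subsequence has nonzero sum. -/
def IsMinZeroSum (G0 : Set G) (A : Multiset G) : Prop :=
  A ≠ 0 ∧ (∀ g ∈ A, g ∈ G0) ∧ A.sum = 0 ∧
    ∀ T : Multiset G, T ≤ A → T.sum = 0 → T = 0 ∨ T = A

/-- `B` is a zero-sum sequence over `G₀ ⊆ G` (an element of `𝓑(G₀)`). -/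
def IsZeroSumSeq (G0 : Set G) (B : Multiset G) : Prop :=
  (∀ g ∈ B, g ∈ G0) ∧ B.sum = 0

/-- The set of lengths `L(B)` of a zero-sum sequence `B` over `G₀`:
all `k` such that `B` is a product of `k` atoms of `𝓑(G₀)`.
(For the trivial sequence this is `{0}`.) -/
def lengthSet (G0 : Set G) (B : Multiset G) : Set ℕ :=
  {k | ∃ U : Fin k → Multiset G, (∀ i, IsMinZeroSum G0 (U i)) ∧ B = ∑ i, U i}

/-- The system of sets of lengths `𝓛(G₀)`. -/
def systemL (G0 : Set G) : Set (Set ℕ) :=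
  {L | ∃ B : Multiset G, IsZeroSumSeq G0 B ∧ L = lengthSet G0 B}

/-- The Davenport constant `D(G)`: the maximal length of a minimal zero-sum
sequence over `G`. -/
noncomputable def davenport (G : Type*) [AddCommGroup G] : ℕ :=
  sSup {m | ∃ A : Multiset G, IsMinZeroSum (Set.univ : Set G) A ∧ Multiset.card A = m}

/-- The set of successive distances `Δ(L)` of a set `L ⊆ ℕ`. -/
def deltaOf (L : Set ℕ) : Set ℕ :=
  {d | 0 < d ∧ ∃ a, a ∈ L ∧ a + d ∈ L ∧ ∀ c ∈ L, ¬(a < c ∧ c < a + d)}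

/-- `Δ(G₀) = ⋃_{L ∈ 𝓛(G₀)} Δ(L)`. -/
def deltaG0 (G0 : Set G) : Set ℕ := ⋃ L ∈ systemL G0, deltaOf L

/-- `Δ*(G) = {min Δ(G₀) : G₀ ⊆ G with Δ(G₀) ≠ ∅}`. -/
def deltaStar (G : Type*) [AddCommGroup G] : Set ℕ :=
  {d | ∃ G0 : Set G, deltaG0 G0 ≠ ∅ ∧ d = sInf (deltaG0 G0)}

/-- The elasticity `ρ(L) = max L / min L` of a (finite) set `L ⊆ ℕ`,
with the convention `ρ({0}) = 1`. -/
noncomputable def rhoL (L : Set ℕ) : ℝ :=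
  if sInf L = 0 then 1 else ((sSup L : ℕ) : ℝ) / ((sInf L : ℕ) : ℝ)

/-- The elasticity `ρ(G₀) = sup {ρ(L) : L ∈ 𝓛(G₀)}`. -/
noncomputable def rhoG0 (G0 : Set G) : ℝ := sSup (rhoL '' systemL G0)

/-- `L` (a set of naturals) is an almost arithmetical progression (AAP)
with difference `d`, length `ℓ` and bound `M`:
`L = y + (L' ∪ {0, d, …, ℓd} ∪ L'') ⊆ y + dℤ` with `L' ⊆ [−M, −1]` and
`L'' ⊆ ℓd + [1, M]`. -/
def IsAAP (L : Set ℕ) (d ℓ M : ℕ) : Prop :=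
  ∃ (y : ℤ) (L1 L2 : Set ℤ),
    L1 ⊆ Set.Icc (-(M : ℤ)) (-1) ∧
    L2 ⊆ Set.Icc ((ℓ : ℤ) * d + 1) ((ℓ : ℤ) * d + M) ∧
    ((fun x : ℕ => (x : ℤ)) '' L) =
      (fun x => y + x) '' (L1 ∪ (fun i : ℤ => (d : ℤ) * i) '' Set.Icc (0 : ℤ) (ℓ : ℤ) ∪ L2) ∧
    (∀ x ∈ L, (d : ℤ) ∣ ((x : ℤ) - y))

/-- `Δ₁(G)`: the set of `d ∈ ℕ` such that for every `k` there is some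
`L ∈ 𝓛(G)` which is an AAP with difference `d` and length at least `k`. -/
def delta1 (G : Type*) [AddCommGroup G] : Set ℕ :=
  {d | 0 < d ∧ ∀ k : ℕ, ∃ L ∈ systemL (Set.univ : Set G), ∃ ℓ ≥ k, ∃ M : ℕ, IsAAP L d ℓ M}

/-- `ρ(G, d, k)`: the supremum of elasticities of sets of lengths of `G` which
are AAPs with difference `d` and length at least `k`. -/
noncomputable def rhoGdk (G : Type*) [AddCommGroup G] (d k : ℕ) : ℝ :=
  sSup (rhoL '' {L | L ∈ systemL (Set.univ : Set G) ∧ ∃ ℓ ≥ k, ∃ M : ℕ, IsAAP L d ℓ M})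

/-- `ρ(G, d)`: the limit of the decreasing sequence `(ρ(G, d, k))_k`,
i.e. its infimum. -/
noncomputable def rhoGd (G : Type*) [AddCommGroup G] (d : ℕ) : ℝ :=
  ⨅ k : ℕ, rhoGdk G d k

/-- `ρ*(G, d) = max {ρ(G₀) : G₀ ⊆ G non-half-factorial with d ∣ min Δ(G₀)}`. -/
noncomputable def rhoStar (G : Type*) [AddCommGroup G] (d : ℕ) : ℝ :=
  sSup {x | ∃ G0 : Set G, deltaG0 G0 ≠ ∅ ∧ d ∣ sInf (deltaG0 G0) ∧ x = rhoG0 G0}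

/-- The cross number `k(S) = Σ_{g ∈ S} 1/ord(g)` of a sequence `S`. -/
noncomputable def crossNum (S : Multiset G) : ℝ :=
  (S.map (fun g => (1 : ℝ) / (addOrderOf g))).sum

/-- `K(G₀) = max {k(A) : A ∈ 𝓐(G₀)}`, the cross number of `G₀`. -/
noncomputable def KG0 (G0 : Set G) : ℝ :=
  sSup {x | ∃ A : Multiset G, IsMinZeroSum G0 A ∧ x = crossNum A}

/-- `K(G, d) = max {K(G₀) : G₀ ⊆ G non-half-factorial with d ∣ min Δ(G₀)}`. -/
noncomputable def KGd (G : Type*) [AddCommGroup G] (d : ℕ) : ℝ :=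
  sSup {x | ∃ G0 : Set G, deltaG0 G0 ≠ ∅ ∧ d ∣ sInf (deltaG0 G0) ∧ x = KG0 G0}

/-- `G₀` is an LCN-set: `k(A) ≥ 1` for every atom `A` of `𝓑(G₀)`. -/
def IsLCN (G0 : Set G) : Prop :=
  ∀ A : Multiset G, IsMinZeroSum G0 A → 1 ≤ crossNum A

end Defs

section Aux

set_option linter.unusedSectionVars false

open Multiset

variable {G : Type*} [AddCommGroup G]

/-- Minimal zero-sum sequence over the whole group. -/
def Atm (A : Multiset G) : Prop :=
  A ≠ 0 ∧ A.sum = 0 ∧ ∀ T : Multiset G, T ≤ A → T.sum = 0 → T = 0 ∨ T = A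

/-- All terms lie in `G0`. -/
def Over (G0 : Finset G) (A : Multiset G) : Prop := ∀ g ∈ A, g ∈ G0

/-- All lengths of factorizations over `G0` of the same element agree modulo `d`. -/
def Cong (d : ℕ) (G0 : Finset G) : Prop :=
  ∀ F F' : Multiset (Multiset G), (∀ A ∈ F, Atm A ∧ Over G0 A) → (∀ A ∈ F', Atm A ∧ Over G0 A) →
    F.sum = F'.sum → F.card ≡ F'.card [MOD d]

/-- Scaled cross number. -/
noncomputable def kap (S : Multiset G) : ℕ :=
  (S.map (fun g => AddMonoid.exponent G / addOrderOf g)).sum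

theorem atm_iff (A : Multiset G) : IsMinZeroSum (Set.univ : Set G) A ↔ Atm A := by
  unfold IsMinZeroSum Atm
  simp

theorem len_iff (B : Multiset G) (k : ℕ) : k ∈ lengthSet (Set.univ : Set G) B ↔
    ∃ F : Multiset (Multiset G), (∀ A ∈ F, Atm A) ∧ F.sum = B ∧ F.card = k := by
  unfold lengthSet
  constructor
  · rintro ⟨U, hU, rfl⟩
    refine ⟨Finset.univ.val.map U, ?_, rfl, by simp⟩
    intro A hA
    simp only [Multiset.mem_map] at hA
    obtain ⟨i, -, rfl⟩ := hA
    exact (atm_iff _).1 (hU i)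
  · rintro ⟨F, hF, rfl, rfl⟩
    induction F using Quotient.inductionOn with
    | h l =>
      refine ⟨fun i => l.get i, fun i => (atm_iff _).2 (hF _ ?_), ?_⟩
      · exact List.get_mem l i
      · simp only [Multiset.quot_mk_to_coe, Multiset.sum_coe]
        exact (List.sum_ofFn (f := fun i => l.get i) ▸ by rw [List.ofFn_get])

theorem exists_fac (B : Multiset G) (hB : B.sum = 0) :
    ∃ F : Multiset (Multiset G), (∀ A ∈ F, Atm A) ∧ F.sum = B := by
  induction h : B.card using Nat.strong_induction_on generalizing B with
  | _ n ih =>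
    by_cases h0 : B = 0
    · exact ⟨0, by simp, by simp [h0]⟩
    by_cases hA : Atm B
    · exact ⟨{B}, by simpa using hA, by simp⟩
    · have : ∃ T : Multiset G, T ≤ B ∧ T.sum = 0 ∧ T ≠ 0 ∧ T ≠ B := by
        by_contra hcon
        push Not at hcon
        apply hA
        refine ⟨h0, hB, fun T hT hs => ?_⟩
        by_cases hT0 : T = 0
        · exact Or.inl hT0
        · exact Or.inr (hcon T hT hs hT0)
      obtain ⟨T, hT, hs, hT0, hTB⟩ := this
      obtain ⟨T', rfl⟩ := Multiset.le_iff_exists_add.1 hT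
      have hT'0 : T' ≠ 0 := by rintro rfl; simp at hTB
      have hs' : T'.sum = 0 := by rw [Multiset.sum_add, hs, zero_add] at hB; exact hB
      have c1 : 0 < T.card := Multiset.card_pos.2 hT0
      have c2 : 0 < T'.card := Multiset.card_pos.2 hT'0
      rw [Multiset.card_add] at h
      obtain ⟨F, hF, rfl⟩ := ih _ (by omega) T hs rfl
      obtain ⟨F', hF', rfl⟩ := ih _ (by omega) T' hs' rfl
      refine ⟨F + F', ?_, by simp⟩
      intro A hA
      rcases Multiset.mem_add.1 hA with h | h
      · exact hF _ h
      · exact hF' _ h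

theorem le_of_mem_fac {F : Multiset (Multiset G)} {A : Multiset G} (h : A ∈ F) : A ≤ F.sum := by
  exact Multiset.single_le_sum (fun _ _ => Multiset.zero_le _) A h

theorem over_of_le {G0 : Finset G} {A B : Multiset G} (h : A ≤ B) (hB : Over G0 B) : Over G0 A :=
  fun g hg => hB g (Multiset.mem_of_le h hg)

theorem over_add {G0 : Finset G} {A B : Multiset G} (hA : Over G0 A) (hB : Over G0 B) :
    Over G0 (A + B) := by
  intro g hg
  rcases Multiset.mem_add.1 hg with h | h
  · exact hA _ h
  · exact hB _ h

theorem mem_msum {F : Multiset (Multiset G)} {g : G} (hg : g ∈ F.sum) : ∃ A ∈ F, g ∈ A := by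
  induction F using Multiset.induction_on with
  | empty => simp at hg
  | cons A F ih =>
    rw [Multiset.sum_cons, Multiset.mem_add] at hg
    rcases hg with h | h
    · exact ⟨A, by simp, h⟩
    · obtain ⟨A', h1, h2⟩ := ih h
      exact ⟨A', by simp [h1], h2⟩

theorem over_sum {G0 : Finset G} {F : Multiset (Multiset G)} (hF : ∀ A ∈ F, Over G0 A) :
    Over G0 F.sum := by
  intro g hg
  obtain ⟨A, hA, h⟩ := mem_msum hg
  exact hF A hA g h

theorem sum_msum {F : Multiset (Multiset G)} (hF : ∀ A ∈ F, Atm A) : F.sum.sum = 0 := by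
  induction F using Multiset.induction_on with
  | empty => simp
  | cons A F ih =>
    rw [Multiset.sum_cons, Multiset.sum_add, (hF A (by simp)).2.1, ih, add_zero]
    exact fun A hA => hF A (by simp [hA])

theorem exists_fac_over {G0 : Finset G} (B : Multiset G) (hB : B.sum = 0) (hO : Over G0 B) :
    ∃ F : Multiset (Multiset G), (∀ A ∈ F, Atm A ∧ Over G0 A) ∧ F.sum = B := by
  obtain ⟨F, hF, rfl⟩ := exists_fac B hB
  exact ⟨F, fun A hA => ⟨hF A hA, over_of_le (le_of_mem_fac hA) hO⟩, rfl⟩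

theorem kap_add (A B : Multiset G) : kap (A + B) = kap A + kap B := by simp [kap]
theorem kap_zero : kap (0 : Multiset G) = 0 := by simp [kap]

theorem kap_sum_eq {F : Multiset (Multiset G)} {e : ℕ} (hF : ∀ A ∈ F, kap A = e) :
    kap F.sum = e * F.card := by
  induction F using Multiset.induction_on with
  | empty => simp [kap_zero]
  | cons A F ih =>
    rw [Multiset.sum_cons, kap_add, hF A (by simp), ih (fun A hA => hF A (by simp [hA]))]
    simp; ring

theorem kap_sum_ge {F : Multiset (Multiset G)} {e : ℕ} (hF : ∀ A ∈ F, e ≤ kap A) :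
    e * F.card ≤ kap F.sum := by
  induction F using Multiset.induction_on with
  | empty => simp
  | cons A F ih =>
    rw [Multiset.sum_cons, kap_add]
    have := hF A (by simp)
    have := ih (fun A hA => hF A (by simp [hA]))
    simp only [Multiset.card_cons]; linarith

theorem kap_sum_le {F : Multiset (Multiset G)} {e : ℕ} (hF : ∀ A ∈ F, kap A ≤ e) :
    kap F.sum ≤ e * F.card := by
  induction F using Multiset.induction_on with
  | empty => simp [kap_zero]
  | cons A F ih =>
    rw [Multiset.sum_cons, kap_add]
    have := hF A (by simp)
    have := ih (fun A hA => hF A (by simp [hA]))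
    simp only [Multiset.card_cons]; linarith

theorem kap_sum_gt {F : Multiset (Multiset G)} {e : ℕ} (hF : ∀ A ∈ F, e ≤ kap A)
    (h : ∃ A ∈ F, kap A ≠ e) : e * F.card < kap F.sum := by
  obtain ⟨A, hA, h⟩ := h
  obtain ⟨F', rfl⟩ := Multiset.exists_cons_of_mem hA
  have h1 := hF A (by simp)
  have h2 := kap_sum_ge (F := F') (e := e) (fun A hA => hF A (by simp [hA]))
  rw [Multiset.sum_cons, kap_add, Multiset.card_cons]
  have : e < kap A := by omega
  linarith

theorem cong_le {d a b : ℕ} (h : a ≡ b [MOD d]) (hab : a < b) : d + a ≤ b := by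
  have := (Nat.modEq_iff_dvd' hab.le).1 h
  have := Nat.le_of_dvd (by omega) this
  omega

variable [Fintype G]

theorem ord_pos (x : G) : 0 < addOrderOf x := addOrderOf_pos x

theorem ord_le (x : G) : addOrderOf x ≤ AddMonoid.exponent G :=
  Nat.le_of_dvd (Nat.pos_of_ne_zero AddMonoid.exponent_ne_zero_of_finite)
    (AddMonoid.addOrder_dvd_exponent x)

theorem exp_pos : 0 < AddMonoid.exponent G :=
  Nat.pos_of_ne_zero AddMonoid.exponent_ne_zero_of_finite

theorem kap_replicate (x : G) (c : ℕ) :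
    kap (replicate (addOrderOf x * c) x) = AddMonoid.exponent G * c := by
  unfold kap
  rw [Multiset.map_replicate, Multiset.sum_replicate, smul_eq_mul]
  obtain ⟨q, hq⟩ := AddMonoid.addOrder_dvd_exponent x
  rw [hq, Nat.mul_div_cancel_left _ (ord_pos x)]
  ring

theorem kap_ord (x : G) : kap (replicate (addOrderOf x) x) = AddMonoid.exponent G := by
  simpa using kap_replicate x 1

theorem card_le_kap (A : Multiset G) : A.card ≤ kap A := by
  induction A using Multiset.induction_on with
  | empty => simp
  | cons a A ih =>
    have : 1 ≤ AddMonoid.exponent G / addOrderOf a :=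
      (Nat.one_le_div_iff (ord_pos a)).2 (ord_le a)
    simp only [kap, Multiset.map_cons, Multiset.sum_cons, Multiset.card_cons] at *
    omega

theorem atm_ord (x : G) : Atm (replicate (addOrderOf x) x) := by
  refine ⟨?_, by simp [addOrderOf_nsmul_eq_zero], fun T hT hs => ?_⟩
  · intro h
    have := congrArg Multiset.card h
    have h2 := ord_pos x
    simp at this
    exact absurd this (by have := ord_pos x; intro h; rw [← addOrderOf_eq_zero_iff] at *; omega)
  · obtain ⟨c, hc, rfl⟩ := Multiset.le_replicate_iff.1 hT
    rw [Multiset.sum_replicate] at hs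
    have hd := addOrderOf_dvd_of_nsmul_eq_zero hs
    rcases Nat.eq_zero_or_pos c with h | h
    · left; simp [h]
    · right; rw [le_antisymm hc (Nat.le_of_dvd h hd)]

theorem atm_eq_ord {U : Multiset G} (hU : Atm U) {x : G} (h : addOrderOf x ≤ U.count x) :
    U = replicate (addOrderOf x) x := by
  rcases hU.2.2 _ (Multiset.le_count_iff_replicate_le.1 h) (atm_ord x).2.1 with h | h
  · exact absurd h (atm_ord x).1
  · exact h.symm

theorem count_msum (F : Multiset (Multiset G)) (x : G) :
    F.sum.count x = (F.map (count x)).sum := by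
  induction F using Multiset.induction_on with
  | empty => simp
  | cons A F ih => simp [ih]

end Aux
section Aux2

set_option linter.unusedSectionVars false

open Multiset

variable {G : Type*} [AddCommGroup G] [Fintype G]

/-- Remove as many blocks `x ^ ord x` as possible. -/
noncomputable def red (P : Multiset G) : Multiset G :=
  ∑ x : G, replicate (P.count x % addOrderOf x) x

/-- The removed blocks. -/
noncomputable def blocks (P : Multiset G) : Multiset (Multiset G) :=
  ∑ x : G, replicate (P.count x / addOrderOf x) (replicate (addOrderOf x) x)

theorem count_red (P : Multiset G) (x : G) : (red P).count x = P.count x % addOrderOf x := by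
  unfold red
  rw [Multiset.count_sum']
  simp [Multiset.count_replicate]

theorem blocks_sum (P : Multiset G) :
    (blocks P).sum = ∑ x : G, replicate (addOrderOf x * (P.count x / addOrderOf x)) x := by
  unfold blocks
  have := map_sum ((Multiset.sumAddMonoidHom : Multiset (Multiset G) →+ Multiset G))
    (fun x : G => replicate (P.count x / addOrderOf x) (replicate (addOrderOf x) x)) Finset.univ
  simp only [Multiset.coe_sumAddMonoidHom] at this
  rw [this]
  refine Finset.sum_congr rfl fun x _ => ?_
  rw [Multiset.sum_replicate, Multiset.nsmul_replicate, mul_comm]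

theorem count_blocks (P : Multiset G) (x : G) :
    (blocks P).sum.count x = addOrderOf x * (P.count x / addOrderOf x) := by
  rw [blocks_sum, Multiset.count_sum']
  simp [Multiset.count_replicate]

theorem red_add_blocks (P : Multiset G) : red P + (blocks P).sum = P := by
  ext x
  rw [Multiset.count_add, count_red, count_blocks]
  exact Nat.mod_add_div _ _

theorem mem_blocks {P A : Multiset G} (h : A ∈ blocks P) : ∃ x, A = replicate (addOrderOf x) x := by
  unfold blocks at h
  rw [Multiset.mem_sum] at h
  obtain ⟨x, -, h⟩ := h
  exact ⟨x, Multiset.eq_of_mem_replicate h⟩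

theorem blocks_atm {P A : Multiset G} (h : A ∈ blocks P) : Atm A ∧ kap A = AddMonoid.exponent G := by
  obtain ⟨x, rfl⟩ := mem_blocks h
  exact ⟨atm_ord x, kap_ord x⟩

theorem blocks_over {G0 : Finset G} {P A : Multiset G} (hP : Over G0 P) (h : A ∈ blocks P) :
    Over G0 A := by
  refine over_of_le ((le_of_mem_fac h).trans ?_) hP
  conv_rhs => rw [← red_add_blocks P]
  exact Multiset.le_add_left _ _

theorem blocks_pos {P : Multiset G} {e : G} (h : addOrderOf e ≤ P.count e) :
    0 < (blocks P).card := by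
  rw [Multiset.card_pos]
  intro h0
  have := count_blocks P e
  rw [h0] at this
  simp at this
  rcases this with h1 | h1
  · exact (ord_pos e).ne' (by simpa using h1)
  · have := ord_pos e
    omega

theorem red_le (P : Multiset G) : red P ≤ P := by
  conv_rhs => rw [← red_add_blocks P]
  exact Multiset.le_add_right _ _

theorem red_sum (P : Multiset G) : (red P).sum = P.sum := by
  conv_rhs => rw [← red_add_blocks P]
  rw [Multiset.sum_add, sum_msum (fun A hA => (blocks_atm hA).1), add_zero]

theorem kap_red (P : Multiset G) :
    kap P = kap (red P) + AddMonoid.exponent G * (blocks P).card := by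
  conv_lhs => rw [← red_add_blocks P]
  rw [kap_add, kap_sum_eq (fun A hA => (blocks_atm hA).2)]

theorem red_add_red (A P : Multiset G) : red (A + red P) = red (A + P) := by
  ext x
  rw [count_red, count_red, Multiset.count_add, Multiset.count_add, count_red]
  simp

theorem red_eq_self {P : Multiset G} (h : ∀ x, P.count x < addOrderOf x) : red P = P := by
  ext x
  rw [count_red, Nat.mod_eq_of_lt (h x)]

/-- `F` consists of atoms over `G0` with cross number one. -/
def Ones (G0 : Finset G) (F : Multiset (Multiset G)) : Prop :=
  ∀ A ∈ F, Atm A ∧ Over G0 A ∧ kap A = AddMonoid.exponent G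

/-- Products of atoms over `G0` with cross number one. -/
def M1 (G0 : Finset G) (P : Multiset G) : Prop := ∃ F, Ones G0 F ∧ F.sum = P

theorem card_le_count_sum {F : Multiset (Multiset G)} {e : G} (h : ∀ A ∈ F, 1 ≤ A.count e) :
    F.card ≤ F.sum.count e := by
  induction F using Multiset.induction_on with
  | empty => simp
  | cons A F ih =>
    have := h A (by simp)
    have := ih (fun A hA => h A (by simp [hA]))
    simp only [Multiset.sum_cons, Multiset.count_add, Multiset.card_cons]; omega

theorem count_sum_le_card {F : Multiset (Multiset G)} {e : G} (h : ∀ A ∈ F, A.count e ≤ 1) :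
    F.sum.count e ≤ F.card := by
  induction F using Multiset.induction_on with
  | empty => simp
  | cons A F ih =>
    have := h A (by simp)
    have := ih (fun A hA => h A (by simp [hA]))
    simp only [Multiset.sum_cons, Multiset.count_add, Multiset.card_cons]; omega

theorem lemmaA {G0 : Finset G} {d : ℕ} (hd : Cong d G0)
    (h1 : ∀ A, Atm A → Over G0 A → AddMonoid.exponent G ≤ kap A)
    {U : Multiset G} (hU : Atm U) (hUo : Over G0 U) (hUk : AddMonoid.exponent G < kap U) :
    d + 2 ≤ G0.card := by
  set W : Multiset (Multiset G) := G0.val.map (fun x => replicate (addOrderOf x) x) with hW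
  have hWa : ∀ A ∈ W, Atm A ∧ Over G0 A ∧ kap A = AddMonoid.exponent G := by
    intro A hA
    rw [hW, Multiset.mem_map] at hA
    obtain ⟨x, hx, rfl⟩ := hA
    refine ⟨atm_ord x, fun g hg => ?_, kap_ord x⟩
    rw [Multiset.eq_of_mem_replicate hg]; exact hx
  have hlt : ∀ x, U.count x < addOrderOf x := by
    intro x
    by_contra h
    rw [atm_eq_ord hU (not_lt.1 h), kap_ord] at hUk
    exact lt_irrefl _ hUk
  have hWc : ∀ x ∈ G0, W.sum.count x = addOrderOf x := by
    intro x hx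
    have : W.sum = ∑ y ∈ G0, replicate (addOrderOf y) y := rfl
    rw [this, Multiset.count_sum']
    simp [Multiset.count_replicate, hx]
  have hUW : U ≤ W.sum := by
    rw [Multiset.le_iff_count]
    intro x
    by_cases hx : x ∈ G0
    · rw [hWc x hx]; exact (hlt x).le
    · rw [Multiset.count_eq_zero_of_notMem (fun h => hx (hUo x h))]; exact Nat.zero_le _
  obtain ⟨V, hV⟩ := Multiset.le_iff_exists_add.1 hUW
  have hWo : Over G0 W.sum := over_sum (fun A hA => (hWa A hA).2.1)
  have hVs : V.sum = 0 := by
    have := sum_msum (fun A hA => (hWa A hA).1)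
    rw [hV, Multiset.sum_add, hU.2.1, zero_add] at this
    exact this
  obtain ⟨F, hF, rfl⟩ := exists_fac_over V hVs
    (over_of_le (by rw [hV]; exact Multiset.le_add_left _ _) hWo)
  have hF0 : F ≠ 0 := by
    rintro rfl
    obtain ⟨x, hx⟩ := Multiset.exists_mem_of_ne_zero hU.1
    have := hWc x (hUo x hx)
    rw [hV] at this
    simp at this
    exact (hlt x).ne this
  have hFc : 0 < F.card := Multiset.card_pos.2 hF0
  have hk : kap W.sum = AddMonoid.exponent G * W.card := kap_sum_eq (fun A hA => (hWa A hA).2.2)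
  have hk2 := kap_sum_ge (F := F) (fun A hA => h1 A (hF A hA).1 (hF A hA).2)
  rw [hV, kap_add] at hk
  have hc := hd (U ::ₘ F) W (by
    intro A hA
    rcases Multiset.mem_cons.1 hA with rfl | h
    · exact ⟨hU, hUo⟩
    · exact hF A h) (fun A hA => ⟨(hWa A hA).1, (hWa A hA).2.1⟩) (by rw [Multiset.sum_cons, hV])
  have hlt2 : (U ::ₘ F).card < W.card := by
    rw [Multiset.card_cons]
    by_contra h
    have := Nat.mul_le_mul_left (AddMonoid.exponent G) (not_lt.1 h)
    rw [mul_add, mul_one] at this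
    omega
  have := cong_le hc hlt2
  rw [Multiset.card_cons] at this
  have hWcard : W.card = G0.card := by rw [hW, Multiset.card_map]; rfl
  omega

theorem lemmaB {G0 : Finset G} {d : ℕ} (hd : Cong d G0)
    (h1 : ∀ A, Atm A → Over G0 A → AddMonoid.exponent G ≤ kap A)
    (h2 : ∀ A, Atm A → Over G0 A → kap A ≠ AddMonoid.exponent G → ∀ x ∈ G0, x ∈ A)
    (hdE : ¬ d + 3 ≤ AddMonoid.exponent G) :
    ∀ F, Ones G0 F → M1 G0 (red F.sum) := by
  intro F
  induction hN : F.card using Nat.strong_induction_on generalizing F with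
  | _ N ih =>
    intro hF
    by_contra hcon
    have hE := exp_pos (G := G)
    have hPo : Over G0 F.sum := over_sum (fun A hA => (hF A hA).2.1)
    -- some block can be removed
    have he : ∃ e, addOrderOf e ≤ F.sum.count e := by
      by_contra h
      push Not at h
      exact hcon ⟨F, hF, (red_eq_self h).symm⟩
    obtain ⟨e, he⟩ := he
    have hcrit : ∀ A F', F = A ::ₘ F' → F'.sum.count e < addOrderOf e := by
      rintro A F' rfl
      by_contra h
      rw [not_lt] at h
      have hF' : Ones G0 F' := fun B hB => hF B (by simp [hB])
      rw [Multiset.card_cons] at hN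
      obtain ⟨F'', hF'', hs⟩ := ih F'.card (by omega) F' rfl hF'
      have k1 : kap F'.sum = _ := kap_sum_eq (fun B hB => (hF' B hB).2.2)
      have k2 : kap F''.sum = _ := kap_sum_eq (fun B hB => (hF'' B hB).2.2)
      have k3 := kap_red F'.sum
      have k4 := blocks_pos h
      rw [← hs, k1, k2, ← mul_add] at k3
      have k5 := Nat.eq_of_mul_eq_mul_left hE k3
      have := ih (A ::ₘ F'').card (by rw [Multiset.card_cons]; omega) _ rfl (by
        intro B hB
        rcases Multiset.mem_cons.1 hB with rfl | h
        · exact hF B (by simp)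
        · exact hF'' B h)
      rw [Multiset.sum_cons, hs, red_add_red, ← Multiset.sum_cons] at this
      exact hcon this
    have hone : ∀ A ∈ F, 1 ≤ A.count e := by
      intro A hA
      obtain ⟨F', rfl⟩ := Multiset.exists_cons_of_mem hA
      have := hcrit A F' rfl
      rw [Multiset.sum_cons, Multiset.count_add] at he
      omega
    have hF0 : F ≠ 0 := by
      rintro rfl
      have := ord_pos e
      simp at he
      exact absurd he (by have := ord_pos e; intro h; rw [← addOrderOf_eq_zero_iff] at h; omega)
    obtain ⟨A, hA⟩ := Multiset.exists_mem_of_ne_zero hF0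
    obtain ⟨F', hFF'⟩ := Multiset.exists_cons_of_mem hA
    have heG : e ∈ G0 := (hF A hA).2.1 e (Multiset.one_le_count_iff_mem.1 (hone A hA))
    have hle := ord_le e
    have hcard1 : F'.card < addOrderOf e := by
      have := hcrit A F' hFF'
      have := card_le_count_sum (F := F') (e := e) (fun B hB => hone B (by rw [hFF']; simp [hB]))
      omega
    have hNF : N = F'.card + 1 := by rw [← hN, hFF', Multiset.card_cons]
    have hF'0 : F' ≠ 0 := by
      rintro rfl
      rw [hFF'] at he hcon
      simp only [Multiset.cons_zero, Multiset.sum_singleton] at he hcon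
      apply hcon
      refine ⟨0, by simp [Ones], ?_⟩
      rw [atm_eq_ord (hF A hA).1 he]
      ext x
      rw [count_red, Multiset.count_replicate]
      split_ifs with h
      · subst h; simp
      · simp
    have hNE : N < AddMonoid.exponent G := by
      by_contra hge
      have hoE : addOrderOf e = AddMonoid.exponent G := by omega
      have hall : ∀ B ∈ F, B.count e ≤ 1 := by
        intro B hB
        obtain ⟨F1, h1'⟩ := Multiset.exists_cons_of_mem hB
        have hF1 : F1.card = F'.card := by
          have := congrArg Multiset.card h1'
          rw [Multiset.card_cons] at this; omega
        have hF1' : F1 ≠ 0 := by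
          rw [← Multiset.card_pos, hF1, Multiset.card_pos]; exact hF'0
        obtain ⟨C, hC⟩ := Multiset.exists_mem_of_ne_zero hF1'
        obtain ⟨F2, rfl⟩ := Multiset.exists_cons_of_mem hC
        have h3 := hcrit C (B ::ₘ F2) (by rw [h1', Multiset.cons_swap])
        rw [Multiset.sum_cons, Multiset.count_add] at h3
        have h4 := card_le_count_sum (F := F2) (e := e)
          (fun D hD => hone D (by rw [h1']; simp [hD]))
        rw [Multiset.card_cons] at hF1
        omega
      have hcount := count_sum_le_card hall
      have hz : (red F.sum).count e = 0 := by
        rw [count_red]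
        have : F.sum.count e = addOrderOf e := by omega
        rw [this, Nat.mod_self]
      obtain ⟨F1, hF1, hs⟩ := exists_fac_over (G0 := G0) (red F.sum)
        (by rw [red_sum]; exact sum_msum (fun A hA => (hF A hA).1))
        (over_of_le (red_le _) hPo)
      apply hcon
      refine ⟨F1, fun B hB => ⟨(hF1 B hB).1, (hF1 B hB).2, ?_⟩, hs⟩
      by_contra hk
      have := h2 B (hF1 B hB).1 (hF1 B hB).2 hk e heG
      have := Multiset.mem_of_le (le_of_mem_fac hB) this
      rw [hs] at this
      exact Multiset.count_eq_zero.1 hz this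
    -- compare lengths
    obtain ⟨F1, hF1, hs⟩ := exists_fac_over (G0 := G0) (red F.sum)
        (by rw [red_sum]; exact sum_msum (fun A hA => (hF A hA).1))
        (over_of_le (red_le _) hPo)
    have hex : ∃ B ∈ F1, kap B ≠ AddMonoid.exponent G := by
      by_contra h
      push Not at h
      exact hcon ⟨F1, fun B hB => ⟨(hF1 B hB).1, (hF1 B hB).2, h B hB⟩, hs⟩
    have hF1c : 0 < F1.card := by
      obtain ⟨B, hB, -⟩ := hex
      exact Multiset.card_pos_iff_exists_mem.2 ⟨B, hB⟩
    have hgt := kap_sum_gt (fun B hB => h1 B (hF1 B hB).1 (hF1 B hB).2) hex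
    rw [hs] at hgt
    have k1 : kap F.sum = _ := kap_sum_eq (fun B hB => (hF B hB).2.2)
    have k3 := kap_red F.sum
    have k4 := blocks_pos he
    have hc := hd (F1 + blocks F.sum) F (by
      intro B hB
      rcases Multiset.mem_add.1 hB with h | h
      · exact hF1 B h
      · exact ⟨(blocks_atm h).1, blocks_over hPo h⟩)
      (fun B hB => ⟨(hF B hB).1, (hF B hB).2.1⟩)
      (by rw [Multiset.sum_add, hs, red_add_blocks])
    have hlt : (F1 + blocks F.sum).card < F.card := by
      rw [Multiset.card_add]
      by_contra h
      have := Nat.mul_le_mul_left (AddMonoid.exponent G) (not_lt.1 h)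
      rw [mul_add] at this
      omega
    have := cong_le hc hlt
    rw [Multiset.card_add] at this
    omega

theorem lemmaD {G0 : Finset G} {d : ℕ} (hd : Cong d G0) {A : Multiset G} (hA : Atm A)
    (hAo : Over G0 A) (hk : kap A < AddMonoid.exponent G) :
    d + kap A ≤ AddMonoid.exponent G ∧ 2 ≤ A.card := by
  constructor
  · set P := AddMonoid.exponent G • A with hP
    have hPo : Over G0 P := fun g hg => hAo g (Multiset.mem_of_mem_nsmul hg)
    have hred : red P = 0 := by
      ext x
      rw [count_red, hP, Multiset.count_nsmul]
      simp only [Multiset.count_zero]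
      exact Nat.mod_eq_zero_of_dvd (Dvd.dvd.mul_right (AddMonoid.addOrder_dvd_exponent x) _)
    have hb := red_add_blocks P
    rw [hred, zero_add] at hb
    have k1 := kap_red P
    rw [hred, kap_zero, zero_add] at k1
    have k2 : kap P = AddMonoid.exponent G * kap A := by
      rw [hP]; simp [kap, Multiset.map_nsmul, Multiset.sum_nsmul]
    rw [k2] at k1
    have k3 := Nat.eq_of_mul_eq_mul_left exp_pos k1
    have hc := hd (blocks P) (replicate (AddMonoid.exponent G) A)
      (fun B hB => ⟨(blocks_atm hB).1, blocks_over hPo hB⟩)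
      (fun B hB => by rw [Multiset.eq_of_mem_replicate hB]; exact ⟨hA, hAo⟩)
      (by rw [hb, Multiset.sum_replicate])
    rw [← k3, Multiset.card_replicate] at hc
    exact cong_le hc hk
  · have h0 : 0 < A.card := Multiset.card_pos.2 hA.1
    by_contra h
    have h1 : A.card = 1 := by omega
    obtain ⟨x, rfl⟩ := Multiset.card_eq_one.1 h1
    have hx : x = 0 := by simpa using hA.2.1
    subst hx
    simp [kap] at hk

end Aux2
section LinAlg

theorem lattice_lemma {ι G : Type*} [Fintype ι] [AddCommGroup G]
    (Φ : (ι → ℤ) →ₗ[ℤ] G) (Λ1 : Submodule ℤ (ι → ℤ))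
    (hne : ¬ LinearMap.ker Φ ≤ Λ1)
    (hcoord : ∀ i, ∀ v ∈ LinearMap.ker Φ, v i = 0 → v ∈ Λ1)
    (r : ℕ) (f : (Fin r → ℤ) →ₗ[ℤ] G) (hf : Function.Surjective f) :
    Fintype.card ι ≤ r + 1 := by
  set Λ := LinearMap.ker Φ with hΛ
  set N0 : Submodule ℤ Λ := Λ1.comap Λ.subtype with hN0
  have hN0t : N0 ≠ ⊤ := by
    intro h
    apply hne
    intro v hv
    have : (⟨v, hv⟩ : Λ) ∈ N0 := by rw [h]; trivial
    exact this
  have : Module.Finite ℤ Λ := inferInstance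
  obtain ⟨N, hN, hle⟩ := (eq_top_or_exists_le_coatom N0).resolve_left hN0t
  have hsimp : IsSimpleModule ℤ (Λ ⧸ N) := isSimpleModule_iff_isCoatom.2 hN
  obtain ⟨I, hI, ⟨e⟩⟩ := isSimpleModule_iff_quot_maximal.1 hsimp
  let _ : Field (ℤ ⧸ I) := Ideal.Quotient.field I
  set ψ : Λ →ₗ[ℤ] (ℤ ⧸ I) := e.toLinearMap ∘ₗ N.mkQ with hψ
  have hψ1 : ∀ v : Λ, (v : ι → ℤ) ∈ Λ1 → ψ v = 0 := by
    intro v hv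
    have : v ∈ N := hle hv
    simp [hψ, (Submodule.Quotient.mk_eq_zero N).2 this]
  have hψ0 : ∃ v, ψ v ≠ 0 := by
    by_contra h
    push Not at h
    apply hN.1
    rw [eq_top_iff]
    intro v _
    have := h v
    simp [hψ] at this
    exact this
  have hk' : ∀ i, ∃ (k : ℤ) (u : Λ), ψ u ≠ 0 ∧ 
      ∀ v : Λ, ∀ a : ℤ, (v : ι → ℤ) i = a * k → ψ v = a • ψ u := by
    intro i
    have hp : (Submodule.map (LinearMap.proj i : (ι → ℤ) →ₗ[ℤ] ℤ) Λ).IsPrincipal :=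
      IsPrincipalIdealRing.principal _
    obtain ⟨k, hk⟩ := hp
    have : k ∈ Submodule.map (LinearMap.proj i : (ι → ℤ) →ₗ[ℤ] ℤ) Λ := by
      rw [hk]; exact Submodule.mem_span_singleton_self k
    obtain ⟨u, hu, huk⟩ := this
    have key : ∀ v : Λ, ∀ a : ℤ, (v : ι → ℤ) i = a * k → ψ v = a • ψ ⟨u, hu⟩ := by
      intro v a hv
      have := hψ1 (v - a • ⟨u, hu⟩) (hcoord i _ (Subtype.property _) (by
        simp only [LinearMap.proj_apply] at huk
        simp [hv, huk]))
      rw [map_sub, map_smul, sub_eq_zero] at this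
      exact this
    refine ⟨k, ⟨u, hu⟩, ?_, key⟩
    intro h0
    obtain ⟨v, hv⟩ := hψ0
    have : (v : ι → ℤ) i ∈ Submodule.map (LinearMap.proj i : (ι → ℤ) →ₗ[ℤ] ℤ) Λ :=
      ⟨v, v.2, rfl⟩
    rw [hk, Submodule.mem_span_singleton] at this
    obtain ⟨a, ha⟩ := this
    apply hv
    rw [key v a ha.symm, h0, smul_zero]
  choose k u hu0 hu using hk'
  by_cases hι : Nonempty ι
  swap
  · rw [not_nonempty_iff] at hι
    simp
  obtain ⟨x0⟩ := hι
  let K : (ι → ℤ) →ₗ[ℤ] (ι → ℤ) := LinearMap.pi fun i => k i • LinearMap.proj i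
  let η : (ι → ℤ) →ₗ[ℤ] G := Φ ∘ₗ K
  let θ : (ι → ℤ) →ₗ[ℤ] ({x : ι // x ≠ x0} → ℤ ⧸ I) :=
    LinearMap.pi fun i => (LinearMap.toSpanSingleton ℤ _ (ψ (u i.1))) ∘ₗ LinearMap.proj i.1
      - (LinearMap.toSpanSingleton ℤ _ (ψ (u x0))) ∘ₗ LinearMap.proj x0
  have hker : ∀ w, η w = 0 → θ w = 0 := by
    intro w hw
    funext i
    have h1 := hu i.1 ⟨K w, hw⟩ (w i.1) (by simp [K, mul_comm])
    have h2 := hu x0 ⟨K w, hw⟩ (w x0) (by simp [K, mul_comm])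
    rw [h1] at h2
    simpa [θ, sub_eq_zero] using h2
  let P : Submodule ℤ (Fin r → ℤ) := (LinearMap.range η).comap f
  have hP : Module.finrank ℤ P ≤ r := by
    simpa using Submodule.finrank_le P
  let b := Module.finBasis ℤ P
  have hb : ∀ j, ∃ w, η w = f (b j) := fun j => (b j).2
  choose w hw using hb
  have hspan : Submodule.span (ℤ ⧸ I) (Set.range fun j => θ (w j)) = ⊤ := by
    have hθ : ∀ v, θ v ∈ Submodule.span (ℤ ⧸ I) (Set.range fun j => θ (w j)) := by
      intro v
      obtain ⟨y, hy⟩ := hf (η v)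
      have hyP : y ∈ P := ⟨v, hy.symm⟩
      have hrepr := b.sum_repr ⟨y, hyP⟩
      have h1 : η (v - ∑ j, b.repr ⟨y, hyP⟩ j • w j) = 0 := by
        rw [map_sub, map_sum, ← hy]
        have := congrArg (fun z : P => f z) hrepr
        simp only [Submodule.coe_sum, Submodule.coe_smul, map_sum, map_smul] at this
        simp only [map_smul, hw]
        rw [this, sub_self]
      have h2 := hker _ h1
      rw [map_sub, map_sum, sub_eq_zero] at h2
      rw [h2]
      refine Submodule.sum_mem _ fun j _ => ?_
      rw [map_smul]
      exact zsmul_mem (Submodule.subset_span (Set.mem_range_self j)) _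
    rw [eq_top_iff, ← Pi.basisFun (ℤ ⧸ I) {x : ι // x ≠ x0} |>.span_eq, Submodule.span_le]
    rintro _ ⟨i, rfl⟩
    have h1 := hθ (Pi.single i.1 1)
    have h2 : θ (Pi.single i.1 1) = ψ (u i.1) • Pi.single i 1 := by
      funext j
      by_cases hij : j = i
      · subst hij
        simp [θ, Pi.single_apply, Ne.symm j.2]
      · have : j.1 ≠ i.1 := fun h => hij (Subtype.ext h)
        simp [θ, Pi.single_apply, this, hij, Ne.symm i.2]
    rw [h2] at h1
    have := Submodule.smul_mem _ (ψ (u i.1))⁻¹ h1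
    rw [smul_smul, inv_mul_cancel₀ (hu0 _), one_smul] at this
    simpa [Pi.basisFun_apply] using this
  have hfin := finrank_le_of_span_eq_top hspan
  simp only [Module.finrank_fintype_fun_eq_card, Fintype.card_fin] at hfin
  rw [Fintype.card_subtype_compl, Fintype.card_subtype_eq] at hfin
  omega

end LinAlg
section Aux3

set_option linter.unusedSectionVars false

open Multiset

variable {G : Type*} [AddCommGroup G] [Fintype G]

/-- Exponent vector of a sequence over `G0`. -/
noncomputable def vec (G0 : Finset G) (A : Multiset G) : G0 → ℤ := fun x => (A.count x.1 : ℤ)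

theorem vec_add (G0 : Finset G) (A B : Multiset G) : vec G0 (A + B) = vec G0 A + vec G0 B := by
  funext x; simp [vec]

theorem lin_vec {G0 : Finset G} {A : Multiset G} (hA : Over G0 A) :
    Fintype.linearCombination ℤ (fun x : G0 => (x : G)) (vec G0 A) = A.sum := by
  rw [Fintype.linearCombination_apply, Finset.sum_multiset_count_of_subset A G0
    (fun g hg => hA g (Multiset.mem_toFinset.1 hg))]
  simp only [vec, natCast_zsmul]
  exact Finset.sum_coe_sort G0 (fun x => A.count x • x)

theorem vec_sum_mem {G0 : Finset G} (P : Submodule ℤ (G0 → ℤ)) {F : Multiset (Multiset G)}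
    (h : ∀ A ∈ F, vec G0 A ∈ P) : vec G0 F.sum ∈ P := by
  induction F using Multiset.induction_on with
  | empty =>
    have : vec G0 (0 : Multiset (Multiset G)).sum = 0 := by funext x; simp [vec]
    rw [this]; exact P.zero_mem
  | cons A F ih =>
    rw [Multiset.sum_cons, vec_add]
    exact P.add_mem (h A (by simp)) (ih fun B hB => h B (by simp [hB]))

theorem lemmaC {G0 : Finset G}
    (h2 : ∀ A, Atm A → Over G0 A → kap A ≠ AddMonoid.exponent G → ∀ x ∈ G0, x ∈ A)
    (hB : ∀ F, Ones G0 F → M1 G0 (red F.sum))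
    {U : Multiset G} (hU : Atm U) (hUo : Over G0 U) (hUk : kap U ≠ AddMonoid.exponent G)
    (r : ℕ) (f : (Fin r → ℤ) →ₗ[ℤ] G) (hf : Function.Surjective f) :
    G0.card ≤ r + 1 := by
  have hlt : ∀ x, U.count x < addOrderOf x := by
    intro x
    by_contra h
    rw [atm_eq_ord hU (not_lt.1 h), kap_ord] at hUk
    exact hUk rfl
  set T : Set (G0 → ℤ) := {v | ∃ A, Atm A ∧ Over G0 A ∧ kap A = AddMonoid.exponent G ∧
    v = vec G0 A} with hT
  have hTo : ∀ y : G0, vec G0 (replicate (addOrderOf y.1) y.1) ∈ Submodule.span ℤ T := by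
    intro y
    refine Submodule.subset_span ⟨_, atm_ord y.1, fun g hg => ?_, kap_ord _, rfl⟩
    rw [Multiset.eq_of_mem_replicate hg]; exact y.2
  have key : ∀ v ∈ Submodule.span ℤ T, ∃ F, Ones G0 F ∧
      ∀ x : G0, (addOrderOf x.1 : ℤ) ∣ v x - (F.sum.count x.1 : ℤ) := by
    intro v hv
    induction hv using Submodule.span_induction with
    | mem v hv =>
      obtain ⟨A, h1, h2, h3, rfl⟩ := hv
      refine ⟨{A}, ?_, ?_⟩
      · intro B hB
        rw [Multiset.mem_singleton.1 hB]; exact ⟨h1, h2, h3⟩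
      · intro x; simp [vec]
    | zero => exact ⟨0, by simp [Ones], by simp⟩
    | add v w _ _ hv hw =>
      obtain ⟨F, hF, h⟩ := hv
      obtain ⟨F', hF', h'⟩ := hw
      refine ⟨F + F', ?_, fun x => ?_⟩
      · intro B hB
        rcases Multiset.mem_add.1 hB with hB | hB
        · exact hF B hB
        · exact hF' B hB
      · have := dvd_add (h x) (h' x)
        rw [Multiset.sum_add, Multiset.count_add, Pi.add_apply]
        push_cast
        have e : v x + w x - ((F.sum.count x.1 : ℤ) + (F'.sum.count x.1 : ℤ)) =
          v x - (F.sum.count x.1 : ℤ) + (w x - (F'.sum.count x.1 : ℤ)) := by ring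
        rw [e]; exact this
    | smul c v _ hv =>
      obtain ⟨F, hF, h⟩ := hv
      have hE : (AddMonoid.exponent G : ℤ) ≠ 0 := by
        have := exp_pos (G := G); omega
      refine ⟨(c % (AddMonoid.exponent G : ℤ)).toNat • F, ?_, fun x => ?_⟩
      · intro B hB
        exact hF B (Multiset.mem_of_mem_nsmul hB)
      · rw [Multiset.sum_nsmul, Multiset.count_nsmul, Pi.smul_apply]
        push_cast
        rw [Int.toNat_of_nonneg (Int.emod_nonneg _ hE)]
        have h1 : (addOrderOf x.1 : ℤ) ∣ c - c % (AddMonoid.exponent G : ℤ) :=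
          (Int.natCast_dvd_natCast.2 (AddMonoid.addOrder_dvd_exponent x.1)).trans
            (Int.dvd_self_sub_emod)
        have := dvd_add ((h x).mul_left c) (h1.mul_right (F.sum.count x.1 : ℤ))
        have e : c • v x - c % (AddMonoid.exponent G : ℤ) * (F.sum.count x.1 : ℤ) =
          c * (v x - (F.sum.count x.1 : ℤ)) +
            (c - c % (AddMonoid.exponent G : ℤ)) * (F.sum.count x.1 : ℤ) := by
          rw [smul_eq_mul]; ring
        rw [e]; exact this
  have := lattice_lemma (Fintype.linearCombination ℤ (fun x : G0 => (x : G)))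
    (Submodule.span ℤ T) ?_ ?_ r f hf
  · simpa using this
  · intro hle
    obtain ⟨F, hF, h⟩ := key (vec G0 U) (hle (by
      rw [LinearMap.mem_ker, lin_vec hUo, hU.2.1]))
    have hFo : Over G0 F.sum := over_sum (fun A hA => (hF A hA).2.1)
    have hr : red F.sum = U := by
      ext x
      rw [count_red]
      by_cases hx : x ∈ G0
      · have h3 : (addOrderOf x : ℤ) ∣ (U.count x : ℤ) - (F.sum.count x : ℤ) := h ⟨x, hx⟩
        have h4 := (Nat.modEq_iff_dvd.2 h3)
        rw [h4, Nat.mod_eq_of_lt (hlt x)]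
      · rw [Multiset.count_eq_zero_of_notMem (fun h => hx (hUo x h)),
          Multiset.count_eq_zero_of_notMem (fun h => hx (hFo x h)), Nat.zero_mod]
    obtain ⟨F', hF', hs⟩ := hB F hF
    rw [hr] at hs
    have h0 : F' ≠ 0 := by
      rintro rfl
      exact hU.1 (by rw [← hs]; simp)
    obtain ⟨A, hA⟩ := Multiset.exists_mem_of_ne_zero h0
    have hAU := le_of_mem_fac hA
    rw [hs] at hAU
    rcases hU.2.2 A hAU (hF' A hA).1.2.1 with h | h
    · exact (hF' A hA).1.1 h
    · rw [← h] at hUk; exact hUk (hF' A hA).2.2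
  · intro x v hv hx
    set S : Multiset G := ∑ y : G0, replicate ((v y + |v y| * addOrderOf y.1).toNat) y.1 with hS
    have hSo : Over G0 S := by
      intro g hg
      rw [hS, Multiset.mem_sum] at hg
      obtain ⟨y, -, hg⟩ := hg
      rw [Multiset.eq_of_mem_replicate hg]; exact y.2
    have hvS : vec G0 S = v + ∑ y : G0, |v y| • vec G0 (replicate (addOrderOf y.1) y.1) := by
      funext z
      have hz : 0 ≤ v z + |v z| * addOrderOf z.1 := by
        have h1 := neg_abs_le (v z)
        have h2 := ord_pos z.1
        have h3 : |v z| * 1 ≤ |v z| * (addOrderOf z.1 : ℤ) :=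
          mul_le_mul_of_nonneg_left (by exact_mod_cast h2) (abs_nonneg _)
        linarith
      simp only [vec, hS, Multiset.count_sum', Multiset.count_replicate, Pi.add_apply,
        Finset.sum_apply, Pi.smul_apply, smul_eq_mul]
      have e1 : ∀ y : G0, (y.1 = z.1) ↔ y = z := fun y => Subtype.ext_iff.symm
      simp only [e1, Nat.cast_ite, Nat.cast_zero, Finset.sum_ite_eq', Finset.mem_univ, if_true,
        mul_ite, mul_zero]
      exact Int.toNat_of_nonneg hz
    have hS0 : S.sum = 0 := by
      rw [← lin_vec hSo, hvS, _root_.map_add, map_sum, LinearMap.mem_ker.1 hv, zero_add]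
      refine Finset.sum_eq_zero fun y _ => ?_
      rw [map_smul, lin_vec, (atm_ord y.1).2.1, smul_zero]
      intro g hg
      rw [Multiset.eq_of_mem_replicate hg]; exact y.2
    have hxS : x.1 ∉ S := by
      intro hg
      rw [hS, Multiset.mem_sum] at hg
      obtain ⟨y, -, hg⟩ := hg
      have : x = y := Subtype.ext (Multiset.eq_of_mem_replicate hg)
      subst this
      rw [hx] at hg
      simp at hg
    obtain ⟨F, hF, hFS⟩ := exists_fac_over S hS0 hSo
    have h3 : vec G0 S ∈ Submodule.span ℤ T := by
      rw [← hFS]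
      refine vec_sum_mem _ fun A hA => Submodule.subset_span ⟨A, (hF A hA).1, (hF A hA).2, ?_, rfl⟩
      by_contra hk
      have := h2 A (hF A hA).1 (hF A hA).2 hk x.1 x.2
      have := Multiset.mem_of_le (le_of_mem_fac hA) this
      rw [hFS] at this
      exact hxS this
    have h4 : v = vec G0 S - ∑ y : G0, |v y| • vec G0 (replicate (addOrderOf y.1) y.1) := by
      rw [hvS]; abel
    rw [h4]
    exact Submodule.sub_mem _ h3 (Submodule.sum_mem _ fun y _ => Submodule.smul_mem _ _ (hTo y))

theorem cong_mono {d : ℕ} {G0 G1 : Finset G} (h : G1 ⊆ G0) (hd : Cong d G0) : Cong d G1 :=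
  fun F F' hF hF' => hd F F' (fun A hA => ⟨(hF A hA).1, fun g hg => h ((hF A hA).2 g hg)⟩)
    (fun A hA => ⟨(hF' A hA).1, fun g hg => h ((hF' A hA).2 g hg)⟩)

theorem lemmaL {r : ℕ} (f : (Fin r → ℤ) →ₗ[ℤ] G) (hf : Function.Surjective f)
    {G0 : Finset G} {d : ℕ} (hd : Cong d G0)
    (h1 : ∀ A, Atm A → Over G0 A → AddMonoid.exponent G ≤ kap A)
    (hU : ∃ U, Atm U ∧ Over G0 U ∧ kap U ≠ AddMonoid.exponent G) :
    d + 1 ≤ r ∨ d + 3 ≤ AddMonoid.exponent G := by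
  induction hN : G0.card using Nat.strong_induction_on generalizing G0 with
  | _ N ih =>
    by_cases hsub : ∃ x ∈ G0, ∃ U, Atm U ∧ Over (G0.erase x) U ∧ kap U ≠ AddMonoid.exponent G
    · obtain ⟨x, hx, hU'⟩ := hsub
      refine ih (G0.erase x).card ?_ (cong_mono (Finset.erase_subset _ _) hd)
        (fun A hA hAo => h1 A hA fun g hg => Finset.erase_subset _ _ (hAo g hg)) hU' rfl
      rw [← hN]; exact Finset.card_erase_lt_of_mem hx
    · have h2 : ∀ A, Atm A → Over G0 A → kap A ≠ AddMonoid.exponent G → ∀ x ∈ G0, x ∈ A := by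
        intro A hA hAo hk x hx
        by_contra hxA
        refine hsub ⟨x, hx, A, hA, fun g hg => Finset.mem_erase.2 ⟨?_, hAo g hg⟩, hk⟩
        rintro rfl; exact hxA hg
      by_cases hdE : d + 3 ≤ AddMonoid.exponent G
      · exact Or.inr hdE
      left
      obtain ⟨U, hUa, hUo, hUk⟩ := hU
      have a1 := lemmaA hd h1 hUa hUo (lt_of_le_of_ne (h1 U hUa hUo) hUk.symm)
      have a2 := lemmaC h2 (lemmaB hd h1 h2 hdE) hUa hUo hUk r f hf
      omega

end Aux3
section Transfer

set_option linter.unusedSectionVars false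

open Multiset Filter

variable {G : Type*} [AddCommGroup G] [Fintype G]

theorem atm_finite : {A : Multiset G | Atm A}.Finite := by
  refine Set.Finite.subset (Set.finite_Iic (AddMonoid.exponent G • (Finset.univ : Finset G).val)) ?_
  intro A hA
  rw [Set.mem_Iic, Multiset.le_iff_count]
  intro x
  rw [Multiset.count_nsmul, Multiset.count_eq_one_of_mem Finset.univ.nodup (Finset.mem_univ x),
    mul_one]
  refine le_trans ?_ (ord_le x)
  by_contra h
  have h1 := atm_eq_ord hA (not_le.1 h).le
  rw [h1, Multiset.count_replicate_self] at h
  exact h le_rfl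

theorem card_out_le {G0 : Finset G} {F : Multiset (Multiset G)} (h : ∀ A ∈ F, ¬ Over G0 A) :
    F.card ≤ (F.sum.filter (fun g => g ∉ G0)).card := by
  induction F using Multiset.induction_on with
  | empty => simp
  | cons A F ih =>
    have h1 := ih (fun A hA => h A (by simp [hA]))
    have h2 : 0 < (A.filter (fun g => g ∉ G0)).card := by
      have := h A (by simp)
      unfold Over at this
      push Not at this
      obtain ⟨g, hg, hg'⟩ := this
      exact Multiset.card_pos_iff_exists_mem.2 ⟨g, Multiset.mem_filter.2 ⟨hg, hg'⟩⟩
    rw [Multiset.sum_cons, Multiset.filter_add, Multiset.card_add, Multiset.card_cons]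
    omega

theorem transfer {d u v : ℕ}
    (h : ∀ k : ℕ, ∃ L ∈ systemL (Set.univ : Set G), u * k ∈ L ∧ v * k ∈ L ∧
      ∀ a ∈ L, ∀ b ∈ L, a ≡ b [MOD d]) :
    ∃ G0 : Finset G, Cong d G0 ∧ ∀ κ1 κ2 : ℕ,
      (∀ A, Atm A → Over G0 A → κ1 ≤ kap A ∧ kap A ≤ κ2) → κ1 * v ≤ κ2 * u := by
  have h' : ∀ k : ℕ, ∃ F F' : Multiset (Multiset G), (∀ A ∈ F, Atm A) ∧ (∀ A ∈ F', Atm A) ∧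
      F'.sum = F.sum ∧ F.card = u * k ∧ F'.card = v * k ∧
      ∀ H H' : Multiset (Multiset G), (∀ A ∈ H, Atm A) → (∀ A ∈ H', Atm A) →
        H.sum = F.sum → H'.sum = F.sum → H.card ≡ H'.card [MOD d] := by
    intro k
    obtain ⟨L, ⟨B, hB, rfl⟩, h1, h2, h3⟩ := h k
    obtain ⟨F, hF, hs, hc⟩ := (len_iff B _).1 h1
    obtain ⟨F', hF', hs', hc'⟩ := (len_iff B _).1 h2
    refine ⟨F, F', hF, hF', by rw [hs, hs'], hc, hc', fun H H' hH hH' e e' => ?_⟩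
    exact h3 _ ((len_iff B _).2 ⟨H, hH, by rw [e, hs], rfl⟩) _
      ((len_iff B _).2 ⟨H', hH', by rw [e', hs], rfl⟩)
  choose F F' hF hF' hs hc hc' hmod using h'
  set At : Finset (Multiset G) := (atm_finite (G := G)).toFinset with hAt
  have hAtm : ∀ A, A ∈ At ↔ Atm A := fun A => by simp [hAt]
  set Good : Multiset G → Prop := fun A => ∀ n : ℕ, ∀ᶠ k in (hyperfilter ℕ : Filter ℕ),
    n ≤ (F k).count A with hGood
  have hbad : ∀ A, ∃ n : ℕ, ¬ Good A → ∀ᶠ k in (hyperfilter ℕ : Filter ℕ), (F k).count A ≤ n := by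
    intro A
    by_cases hA : Good A
    · exact ⟨0, fun h => absurd hA h⟩
    · simp only [hGood, not_forall] at hA
      obtain ⟨n, hn⟩ := hA
      refine ⟨n, fun _ => ?_⟩
      rw [← Ultrafilter.eventually_not] at hn
      exact hn.mono fun k hk => (not_le.1 hk).le
  choose nb hnb using hbad
  set gd : Finset (Multiset G) := At.filter Good with hgd
  set G0 : Finset G := gd.biUnion (fun A => A.toFinset) with hG0
  have hgo : ∀ A ∈ gd, Over G0 A := by
    intro A hA g hg
    exact Finset.mem_biUnion.2 ⟨A, hA, Multiset.mem_toFinset.2 hg⟩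
  refine ⟨G0, ?_, ?_⟩
  · intro H H' hH hH' hHs
    set B := H.sum with hB
    have hBo : Over G0 B := over_sum fun A hA => (hH A hA).2
    have hev : ∀ᶠ k in (hyperfilter ℕ : Filter ℕ), ∀ A ∈ gd, B.card ≤ (F k).count A := by
      rw [Filter.eventually_all_finset]
      intro A hA
      exact (Finset.mem_filter.1 hA).2 _
    obtain ⟨k, hk⟩ := hev.exists
    have hle : B.card • gd.val ≤ F k := by
      rw [Multiset.le_iff_count]
      intro A
      rw [Multiset.count_nsmul]
      by_cases hA : A ∈ gd
      · rw [Multiset.count_eq_one_of_mem gd.nodup hA, mul_one]; exact hk A hA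
      · rw [Multiset.count_eq_zero_of_notMem hA]; simp
    obtain ⟨R, hR⟩ := Multiset.le_iff_exists_add.1 hle
    have hBle : B ≤ (B.card • gd.val).sum := by
      rw [Multiset.le_iff_count]
      intro x
      by_cases hx : x ∈ B
      · obtain ⟨A, hA, hxA⟩ := Finset.mem_biUnion.1 (hBo x hx)
        rw [Multiset.sum_nsmul, Multiset.count_nsmul]
        have h1 : 1 ≤ (gd.val.sum).count x :=
          Multiset.one_le_count_iff_mem.2 (Multiset.mem_of_le (le_of_mem_fac hA)
            (Multiset.mem_toFinset.1 hxA))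
        calc B.count x ≤ B.card * 1 := by rw [mul_one]; exact Multiset.count_le_card _ _
          _ ≤ _ := Nat.mul_le_mul_left _ h1
      · rw [Multiset.count_eq_zero_of_notMem hx]; exact Nat.zero_le _
    obtain ⟨C, hC⟩ := Multiset.le_iff_exists_add.1 hBle
    have hC0 : C.sum = 0 := by
      have h1 : (B.card • gd.val).sum.sum = 0 := sum_msum fun A hA =>
        hF k A (Multiset.mem_of_le hle hA)
      rw [hC, Multiset.sum_add, hB, sum_msum fun A hA => (hH A hA).1, zero_add] at h1
      exact h1
    obtain ⟨H'', hH'', hH''s⟩ := exists_fac C hC0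
    have hRa : ∀ A ∈ R, Atm A := fun A hA => hF k A (by rw [hR]; simp [hA])
    have := hmod k (H + (H'' + R)) (H' + (H'' + R)) ?_ ?_ ?_ ?_
    · rw [Multiset.card_add, Multiset.card_add H'] at this
      exact Nat.ModEq.add_right_cancel' _ this
    · intro A hA
      simp only [Multiset.mem_add] at hA
      rcases hA with hA | hA | hA
      · exact (hH A hA).1
      · exact hH'' A hA
      · exact hRa A hA
    · intro A hA
      simp only [Multiset.mem_add] at hA
      rcases hA with hA | hA | hA
      · exact (hH' A hA).1
      · exact hH'' A hA
      · exact hRa A hA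
    · rw [hR, Multiset.sum_add, Multiset.sum_add, Multiset.sum_add (B.card • gd.val), hC, hH''s, hB]
      rw [add_assoc]
    · rw [hR, Multiset.sum_add, Multiset.sum_add, Multiset.sum_add (B.card • gd.val), hC, hH''s,
        ← hHs]
      rw [add_assoc]
  · intro κ1 κ2 hκ
    set D : ℕ := At.sup kap with hD
    have hDk : ∀ A, Atm A → kap A ≤ D := fun A hA => Finset.le_sup ((hAtm A).2 hA)
    set c : ℕ := ∑ A ∈ At, nb A with hcdef
    by_contra hcon
    rw [not_le] at hcon
    have hev : ∀ᶠ k in (hyperfilter ℕ : Filter ℕ), ∀ A ∈ At, ¬ Good A → (F k).count A ≤ nb A := by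
      rw [Filter.eventually_all_finset]
      intro A hA
      by_cases hg : Good A
      · exact Filter.Eventually.of_forall fun k h => absurd hg h
      · exact (hnb A hg).mono fun k hk _ => hk
    have hbig : ∀ᶠ k in (hyperfilter ℕ : Filter ℕ), D * c + κ1 * (D * c) < k := by
      apply Filter.hyperfilter_le_cofinite
      rw [Nat.cofinite_eq_atTop]
      exact Filter.eventually_gt_atTop _
    obtain ⟨k, hk1, hk2⟩ := (hev.and hbig).exists
    set Fg := (F k).filter Good with hFg
    set Fb := (F k).filter (fun A => ¬ Good A) with hFb
    have hsplit : Fg + Fb = F k := Multiset.filter_add_not _ _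
    have hFbc : Fb.card ≤ c := by
      rw [← Multiset.sum_count_eq_card (s := At) (m := Fb) (fun A hA =>
        (hAtm A).2 (hF k A (Multiset.mem_filter.1 hA).1))]
      refine Finset.sum_le_sum fun A hA => ?_
      by_cases hg : Good A
      · rw [Multiset.count_eq_zero_of_notMem]
        · exact Nat.zero_le _
        · intro h; exact (Multiset.mem_filter.1 h).2 hg
      · exact (Multiset.count_le_of_le _ (Multiset.filter_le _ _)).trans (hk1 A hA hg)
    have hFgo : ∀ A ∈ Fg, Atm A ∧ Over G0 A := by
      intro A hA
      have h1 := Multiset.mem_filter.1 hA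
      exact ⟨hF k A h1.1, hgo A (Finset.mem_filter.2 ⟨(hAtm A).2 (hF k A h1.1), h1.2⟩)⟩
    have hFgc : Fg.card ≤ u * k := by
      rw [← hc k]; exact Multiset.card_le_card (Multiset.filter_le _ _)
    have k1 : kap Fg.sum ≤ κ2 * Fg.card :=
      kap_sum_le fun A hA => (hκ A (hFgo A hA).1 (hFgo A hA).2).2
    have k2 : kap Fb.sum ≤ D * Fb.card :=
      kap_sum_le fun A hA => hDk A (hF k A (Multiset.mem_filter.1 hA).1)
    have k3 : kap (F k).sum = kap Fg.sum + kap Fb.sum := by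
      rw [← hsplit, Multiset.sum_add, kap_add]
    set Fo := (F' k).filter (Over G0) with hFo
    set Fn := (F' k).filter (fun A => ¬ Over G0 A) with hFn
    have hsplit' : Fo + Fn = F' k := Multiset.filter_add_not _ _
    have k4 : κ1 * Fo.card ≤ kap Fo.sum :=
      kap_sum_ge fun A hA => (hκ A (hF' k A (Multiset.mem_filter.1 hA).1)
        (Multiset.mem_filter.1 hA).2).1
    have k5 : kap (F' k).sum = kap Fo.sum + kap Fn.sum := by
      rw [← hsplit', Multiset.sum_add, kap_add]
    have k6 : Fn.card ≤ D * c := by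
      have h1 := card_out_le (G0 := G0) (F := Fn) fun A hA => (Multiset.mem_filter.1 hA).2
      have h2 : Fn.sum ≤ (F k).sum := by
        rw [← hs k, ← hsplit', Multiset.sum_add]; exact Multiset.le_add_left _ _
      have h3 := Multiset.card_le_card (Multiset.filter_le_filter (fun g => g ∉ G0) h2)
      rw [← hsplit, Multiset.sum_add, Multiset.filter_add] at h3
      have h4 : Fg.sum.filter (fun g => g ∉ G0) = 0 := by
        rw [Multiset.filter_eq_nil]
        intro g hg
        exact not_not.2 (over_sum (fun A hA => (hFgo A hA).2) g hg)
      rw [h4, zero_add] at h3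
      have h5 := Multiset.card_le_card (Multiset.filter_le (fun g => g ∉ G0) Fb.sum)
      have h6 := card_le_kap Fb.sum
      have h7 := Nat.mul_le_mul_left D hFbc
      omega
    have k7 : Fo.card + Fn.card = v * k := by rw [← hc' k, ← hsplit', Multiset.card_add]
    rw [hs k] at k5
    have k8 := Nat.mul_le_mul_left κ1 k6
    have k9 := Nat.mul_le_mul_left D hFbc
    have k10 := Nat.mul_le_mul_left κ2 hFgc
    have k11 : κ1 * Fo.card + κ1 * Fn.card = κ1 * v * k := by rw [← mul_add, k7, mul_assoc]
    have k12 := Nat.mul_le_mul_right k (Nat.succ_le_of_lt hcon)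
    rw [Nat.succ_mul] at k12
    rw [← mul_assoc] at k10
    omega

end Transfer
section Patterns

set_option linter.unusedSectionVars false

open Multiset

variable {G : Type*} [AddCommGroup G] [Fintype G]

theorem weight_cong {q d : ℕ} (hq : 0 < q) {G0 : Finset G} (w : G → ℕ)
    (hw : ∀ A, Atm A → Over G0 A → (A.map w).sum ≡ q [MOD q * d])
    {B : Multiset G} (hB : Over G0 B) :
    ∀ a ∈ lengthSet (Set.univ : Set G) B, ∀ b ∈ lengthSet (Set.univ : Set G) B, a ≡ b [MOD d] := by
  have key : ∀ F : Multiset (Multiset G), (∀ A ∈ F, Atm A ∧ Over G0 A) →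
      (F.sum.map w).sum ≡ q * F.card [MOD q * d] := by
    intro F
    induction F using Multiset.induction_on with
    | empty => intro _; simpa using Nat.ModEq.refl 0
    | cons A F ih =>
      intro h
      have h1 := ih fun A hA => h A (by simp [hA])
      have h2 := hw A (h A (by simp)).1 (h A (by simp)).2
      rw [Multiset.sum_cons, Multiset.map_add, Multiset.sum_add, Multiset.card_cons, mul_add,
        mul_one, add_comm (q * _)]
      exact h2.add h1
  intro a ha b hb
  obtain ⟨F, hF, hs, rfl⟩ := (len_iff B _).1 ha
  obtain ⟨F', hF', hs', rfl⟩ := (len_iff B _).1 hb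
  have k1 := key F fun A hA => ⟨hF A hA, over_of_le (le_of_mem_fac hA) (by rw [hs]; exact hB)⟩
  have k2 := key F' fun A hA => ⟨hF' A hA, over_of_le (le_of_mem_fac hA) (by rw [hs']; exact hB)⟩
  rw [hs] at k1
  rw [hs'] at k2
  exact Nat.ModEq.mul_left_cancel' hq.ne' (k1.symm.trans k2)

theorem atm_of_le {A T : Multiset G} (hA : Atm A) (hT : T ≤ A) (h0 : T ≠ 0) (hs : T.sum = 0) :
    A = T := ((hA.2.2 T hT hs).resolve_left h0).symm

theorem patternA {g : G} {m : ℕ} (hg : addOrderOf g = m) (hm : 3 ≤ m) (k : ℕ) :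
    ∃ L ∈ systemL (Set.univ : Set G), 2 * k ∈ L ∧ m * k ∈ L ∧
      ∀ a ∈ L, ∀ b ∈ L, a ≡ b [MOD (m - 2)] := by
  have hgn : g ≠ -g := by
    intro h
    have h2 : 2 • g = 0 := by rw [two_nsmul]; nth_rewrite 2 [h]; simp
    have := Nat.le_of_dvd (by norm_num) (addOrderOf_dvd_of_nsmul_eq_zero h2)
    omega
  have hgo : addOrderOf (-g) = m := by rw [addOrderOf_neg, hg]
  have a1 : Atm (replicate m g) := by rw [← hg]; exact atm_ord g
  have a2 : Atm (replicate m (-g)) := by rw [← hgo]; exact atm_ord (-g)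
  have hg0 : g ≠ 0 := by
    rintro rfl; rw [neg_zero] at hgn; exact hgn rfl
  have a3 : Atm ({g, -g} : Multiset G) := by
    refine ⟨by simp, by simp, fun T hT hs => ?_⟩
    have hc := Multiset.card_le_card hT
    simp at hc
    by_cases h0 : T = 0
    · exact Or.inl h0
    right
    refine Multiset.eq_of_le_of_card_le hT ?_
    have := Multiset.card_pos.2 h0
    by_contra hlt
    have h1 : T.card = 1 := by simp at hlt; omega
    obtain ⟨x, rfl⟩ := Multiset.card_eq_one.1 h1
    have hx : x ∈ ({g, -g} : Multiset G) := Multiset.mem_of_le hT (by simp)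
    simp at hx hs
    rcases hx with rfl | rfl
    · exact hg0 hs
    · exact hg0 (neg_eq_zero.1 hs)
  set B := replicate (m * k) g + replicate (m * k) (-g) with hB
  have hBs : B.sum = 0 := by
    rw [hB, Multiset.sum_add, Multiset.sum_replicate, Multiset.sum_replicate]
    simp
  refine ⟨_, ⟨B, ⟨fun _ _ => trivial, hBs⟩, rfl⟩, ?_, ?_, ?_⟩
  · refine (len_iff B _).2 ⟨replicate k (replicate m g) + replicate k (replicate m (-g)), ?_, ?_, ?_⟩
    · intro A hA
      rcases Multiset.mem_add.1 hA with h | h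
      · rw [Multiset.eq_of_mem_replicate h]; exact a1
      · rw [Multiset.eq_of_mem_replicate h]; exact a2
    · rw [Multiset.sum_add, Multiset.sum_replicate, Multiset.sum_replicate,
        Multiset.nsmul_replicate, Multiset.nsmul_replicate, hB, mul_comm]
    · simp; ring
  · refine (len_iff B _).2 ⟨replicate (m * k) {g, -g}, ?_, ?_, by simp⟩
    · intro A hA
      rw [Multiset.eq_of_mem_replicate hA]; exact a3
    · rw [Multiset.sum_replicate, hB]
      rw [Multiset.insert_eq_cons, ← Multiset.singleton_add, smul_add, Multiset.nsmul_singleton,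
        Multiset.nsmul_singleton]
  · refine weight_cong (q := m) (G0 := {g, -g}) (by omega) (fun x => if x = g then 1 else m - 1)
      ?_ ?_
    · intro A hA hAo
      by_cases h1 : g ∈ A
      · by_cases h2 : -g ∈ A
        · have : A = {g, -g} := by
            refine atm_of_le hA ?_ a3.1 a3.2.1
            rw [Multiset.le_iff_count]
            intro x
            have i1 := Multiset.one_le_count_iff_mem.2 h1
            have i2 := Multiset.one_le_count_iff_mem.2 h2
            simp only [Multiset.insert_eq_cons, Multiset.count_cons, Multiset.count_singleton]
            split_ifs with c1 c2 c2
            · exact absurd (c2.symm.trans c1) hgn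
            · subst c1; simpa using i2
            · subst c2; simpa using i1
            · simp
          rw [this]
          simp [hgn.symm]
          rw [show 1 + (m - 1) = m by omega]
        · have : A = replicate A.card g := by
            rw [Multiset.eq_replicate]
            refine ⟨rfl, fun b hb => ?_⟩
            have := hAo b hb
            simp at this
            rcases this with h | h
            · exact h
            · rw [h] at hb; exact absurd hb h2
          have hs := hA.2.1
          rw [this, Multiset.sum_replicate] at hs
          have hdv := addOrderOf_dvd_of_nsmul_eq_zero hs
          rw [hg] at hdv
          have hle := Nat.le_of_dvd (Multiset.card_pos.2 hA.1) hdv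
          have : A = replicate m g := by
            refine atm_of_le hA ?_ a1.1 a1.2.1
            rw [this]; exact (Multiset.replicate_le_replicate g).2 hle
          rw [this]; simp
          exact Nat.ModEq.refl _
      · have : A = replicate A.card (-g) := by
          rw [Multiset.eq_replicate]
          refine ⟨rfl, fun b hb => ?_⟩
          have := hAo b hb
          simp at this
          rcases this with h | h
          · rw [h] at hb; exact absurd hb h1
          · exact h
        have hs := hA.2.1
        rw [this, Multiset.sum_replicate] at hs
        have hdv := addOrderOf_dvd_of_nsmul_eq_zero hs
        rw [hgo] at hdv
        have hle := Nat.le_of_dvd (Multiset.card_pos.2 hA.1) hdv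
        have : A = replicate m (-g) := by
          refine atm_of_le hA ?_ a2.1 a2.2.1
          rw [this]; exact (Multiset.replicate_le_replicate _).2 hle
        rw [this]; simp [hgn.symm]
        obtain ⟨j, rfl⟩ : ∃ j, m = j + 2 := ⟨m - 2, by omega⟩
        have : (j + 2) * (j + 2 - 1) = (j + 2) + (j + 2) * (j + 2 - 2) := by
          simp; ring
        rw [this]
        simp [Nat.ModEq]
    · intro x hx
      rw [hB] at hx
      rcases Multiset.mem_add.1 hx with h | h
      · rw [Multiset.eq_of_mem_replicate h]; simp
      · rw [Multiset.eq_of_mem_replicate h]; simp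

theorem patternB {r q : ℕ} (hr : 2 ≤ r) (hq : 2 ≤ q) (e : Fin r → G) (he : ∀ i, q • e i = 0)
    (hind : ∀ c : Fin r → ℕ, ∑ i, c i • e i = 0 → ∀ i, q ∣ c i) (k : ℕ) :
    ∃ L ∈ systemL (Set.univ : Set G), q * k ∈ L ∧ (1 + r * (q - 1)) * k ∈ L ∧
      ∀ a ∈ L, ∀ b ∈ L, a ≡ b [MOD (r - 1)] := by
  set e0 : G := ∑ i, e i with he0
  have hinj : Function.Injective e := by
    intro i j hij
    by_contra hne
    have := hind (fun l => if l = i then 1 else if l = j then q - 1 else 0) (by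
      have : ∀ l, (if l = i then 1 else if l = j then q - 1 else 0) • e l =
          (if l = i then e i else 0) + (if l = j then (q - 1) • e i else 0) := by
        intro l
        split_ifs with h1 h2 h2
        · exact absurd (h1.symm.trans h2) hne
        · simp [h1]
        · rw [h2, hij]; simp
        · simp
      rw [Finset.sum_congr rfl fun l _ => this l, Finset.sum_add_distrib]
      simp
      rw [← succ_nsmul', show q - 1 + 1 = q by omega, he]) i
    simp at this
    omega
  have he0i : ∀ i, e0 ≠ e i := by
    intro i h
    obtain ⟨j, hj⟩ : ∃ j : Fin r, j ≠ i := by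
      have : Nontrivial (Fin r) := Fin.nontrivial_iff_two_le.2 hr
      exact exists_ne i
    have := hind (fun l => if l = i then 0 else 1) (by
      have h1 : ∀ l, (if l = i then 0 else 1) • e l = e l - (if l = i then e i else 0) := by
        intro l
        split_ifs with h1
        · simp [h1]
        · simp
      rw [Finset.sum_congr rfl fun l _ => h1 l, Finset.sum_sub_distrib, ← he0]
      simp [h]) j
    simp [hj] at this
    omega
  have hqe0 : q • e0 = 0 := by
    rw [he0, Finset.smul_sum]; exact Finset.sum_eq_zero fun i _ => he i
  have ho : ∀ i, addOrderOf (e i) = q := by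
    intro i
    refine Nat.dvd_antisymm (addOrderOf_dvd_of_nsmul_eq_zero (he i)) ?_
    have := hind (fun l => if l = i then addOrderOf (e i) else 0) (by
      rw [Finset.sum_eq_single i]
      · simp [addOrderOf_nsmul_eq_zero]
      · intro j _ hj; simp [hj]
      · simp) i
    simpa using this
  have ho0 : addOrderOf e0 = q := by
    refine Nat.dvd_antisymm (addOrderOf_dvd_of_nsmul_eq_zero hqe0) ?_
    exact hind (fun l => addOrderOf e0) (by
      rw [← Finset.smul_sum, ← he0]; exact addOrderOf_nsmul_eq_zero _) ⟨0, by omega⟩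
  have a0 : Atm (replicate q e0) := by rw [← ho0]; exact atm_ord e0
  have ai : ∀ i, Atm (replicate q (e i)) := by
    intro i; have := atm_ord (e i); rw [ho i] at this; exact this
  set G0 : Finset G := insert e0 (Finset.univ.image e) with hG0
  have hsumG0 : ∀ (φ : G → G),
      ∑ x ∈ G0, φ x = φ e0 + ∑ i, φ (e i) := by
    intro φ
    rw [hG0, Finset.sum_insert, Finset.sum_image (fun i _ j _ h => hinj h)]
    simp only [Finset.mem_image, not_exists, not_and]
    exact fun i _ h => he0i i h.symm
  have hsumN : ∀ (φ : G → ℕ),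
      ∑ x ∈ G0, φ x = φ e0 + ∑ i, φ (e i) := by
    intro φ
    rw [hG0, Finset.sum_insert, Finset.sum_image (fun i _ j _ h => hinj h)]
    simp only [Finset.mem_image, not_exists, not_and]
    exact fun i _ h => he0i i h.symm
  have hAsum : ∀ A, Over G0 A → A.sum = ∑ i, (A.count e0 + A.count (e i)) • e i := by
    intro A hA
    rw [Finset.sum_multiset_count_of_subset A G0 (fun g hg => hA g (Multiset.mem_toFinset.1 hg)),
      hsumG0]
    simp only [add_smul, Finset.sum_add_distrib, ← Finset.smul_sum]
    rfl
  have hdvd : ∀ A, Over G0 A → A.sum = 0 → ∀ i, q ∣ A.count e0 + A.count (e i) := by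
    intro A hA hs
    rw [hAsum A hA] at hs
    exact hind _ hs
  have hmem : ∀ x ∈ G0, x = e0 ∨ ∃ i, x = e i := by
    intro x hx
    rw [hG0, Finset.mem_insert, Finset.mem_image] at hx
    rcases hx with h | ⟨i, -, h⟩
    · exact Or.inl h
    · exact Or.inr ⟨i, h.symm⟩
  have m0 : e0 ∈ G0 := by simp [hG0]
  have mi : ∀ i, e i ∈ G0 := by simp [hG0]
  set V : Multiset G := {e0} + ∑ i, replicate (q - 1) (e i) with hV
  have hVo : Over G0 V := by
    intro x hx
    rw [hV, Multiset.mem_add, Multiset.mem_sum] at hx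
    rcases hx with h | ⟨i, -, h⟩
    · rw [Multiset.mem_singleton.1 h]; exact m0
    · rw [Multiset.eq_of_mem_replicate h]; exact mi i
  have hV0 : V.count e0 = 1 := by
    rw [hV, Multiset.count_add, Multiset.count_sum']
    simp [Multiset.count_replicate, fun i => (he0i i).symm]
  have hVi : ∀ i, V.count (e i) = q - 1 := by
    intro i
    rw [hV, Multiset.count_add, Multiset.count_sum']
    simp [Multiset.count_replicate, Multiset.count_singleton, (he0i i).symm, hinj.eq_iff]
  have hVa : Atm V := by
    refine ⟨?_, ?_, ?_⟩
    · intro h; rw [h] at hV0; simp at hV0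
    · rw [hAsum V hVo, Finset.sum_eq_zero]
      intro i _
      rw [hV0, hVi, show 1 + (q - 1) = q by omega, he]
    · intro T hT hs
      have hTo := over_of_le hT hVo
      have hd := hdvd T hTo hs
      have c0 := Multiset.count_le_of_le e0 hT
      have ci := fun i => Multiset.count_le_of_le (e i) hT
      simp only [hV0, hVi] at c0 ci
      by_cases h0 : T.count e0 = 0
      · left
        rw [Multiset.eq_zero_iff_forall_notMem]
        intro x hx
        have hx' := Multiset.one_le_count_iff_mem.2 hx
        rcases hmem x (hTo x hx) with rfl | ⟨i, rfl⟩
        · omega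
        · have := Nat.le_of_dvd (by omega) (hd i)
          have := ci i
          omega
      · right
        ext x
        by_cases hx : x ∈ G0
        · rcases hmem x hx with rfl | ⟨i, rfl⟩
          · rw [hV0]; omega
          · rw [hVi]
            have := Nat.le_of_dvd (by omega) (hd i)
            have := ci i
            omega
        · rw [Multiset.count_eq_zero_of_notMem (fun h => hx (hTo x h)),
            Multiset.count_eq_zero_of_notMem (fun h => hx (hVo x h))]
  set B : Multiset G := (q * k) • V with hB
  have hBs : B.sum = 0 := by rw [hB, Multiset.sum_nsmul, hVa.2.1, smul_zero]
  refine ⟨_, ⟨B, ⟨fun _ _ => trivial, hBs⟩, rfl⟩, ?_, ?_, ?_⟩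
  · refine (len_iff B _).2 ⟨replicate (q * k) V, ?_, ?_, by simp⟩
    · intro A hA
      rw [Multiset.eq_of_mem_replicate hA]; exact hVa
    · rw [Multiset.sum_replicate]
  · refine (len_iff B _).2 ⟨replicate k (replicate q e0) +
      ∑ i, replicate ((q - 1) * k) (replicate q (e i)), ?_, ?_, ?_⟩
    · intro A hA
      rw [Multiset.mem_add, Multiset.mem_sum] at hA
      rcases hA with h | ⟨i, -, h⟩
      · rw [Multiset.eq_of_mem_replicate h]; exact a0
      · rw [Multiset.eq_of_mem_replicate h]; exact ai i
    · have := map_sum (Multiset.sumAddMonoidHom : Multiset (Multiset G) →+ Multiset G)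
        (fun i : Fin r => replicate ((q - 1) * k) (replicate q (e i))) Finset.univ
      simp only [Multiset.coe_sumAddMonoidHom] at this
      rw [Multiset.sum_add, this, hB, hV, smul_add, Finset.smul_sum]
      simp only [Multiset.sum_replicate, Multiset.nsmul_replicate, Multiset.nsmul_singleton]
      congr 1
      · rw [mul_comm]
      · refine Finset.sum_congr rfl fun i _ => ?_
        congr 1; ring
    · rw [Multiset.card_add, Multiset.card_sum]
      simp
      ring
  · refine weight_cong (q := q) (G0 := G0) (by omega) (fun x => if x = e0 then r else 1) ?_ ?_
    · have hrq : r * q ≡ q [MOD q * (r - 1)] := by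
        have : r * q = q + q * (r - 1) := by
          obtain ⟨j, rfl⟩ : ∃ j, r = j + 1 := ⟨r - 1, by omega⟩
          simp; ring
        rw [this]; simp [Nat.ModEq]
      intro A hA hAo
      by_cases h0 : q ≤ A.count e0
      · have : A = replicate q e0 :=
          atm_of_le hA (Multiset.le_count_iff_replicate_le.1 h0) a0.1 a0.2.1
        rw [this]
        simp
        rw [mul_comm q r]; exact hrq
      by_cases hi : ∃ i, q ≤ A.count (e i)
      · obtain ⟨i, hi⟩ := hi
        have : A = replicate q (e i) :=
          atm_of_le hA (Multiset.le_count_iff_replicate_le.1 hi) (ai i).1 (ai i).2.1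
        rw [this]
        simp [(he0i i).symm]
        exact Nat.ModEq.refl _
      push Not at hi h0
      have hd := hdvd A hAo hA.2.1
      have hpos : 0 < A.count e0 := by
        by_contra hz
        apply hA.1
        rw [Multiset.eq_zero_iff_forall_notMem]
        intro x hx
        have hx' := Multiset.one_le_count_iff_mem.2 hx
        rcases hmem x (hAo x hx) with rfl | ⟨i, rfl⟩
        · omega
        · have := Nat.le_of_dvd (by omega) (hd i)
          have := hi i
          omega
      have hci : ∀ i, A.count (e i) = q - A.count e0 := by
        intro i
        obtain ⟨t, ht⟩ := hd i
        have := hi i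
        have t1 : t = 1 := by
          have : q * t < q * 2 := by omega
          have := Nat.lt_of_mul_lt_mul_left this
          have : t ≠ 0 := by rintro rfl; omega
          omega
        subst t1
        omega
      have hwt : (A.map (fun x => if x = e0 then r else 1)).sum = r * q := by
        rw [Finset.sum_multiset_map_count]
        have hsub : A.toFinset ⊆ G0 := fun g hg => hAo g (Multiset.mem_toFinset.1 hg)
        rw [Finset.sum_subset hsub (fun x _ hx => by
          rw [Multiset.count_eq_zero_of_notMem (fun h => hx (Multiset.mem_toFinset.2 h)), zero_smul]),
          hsumN]
        simp only [hci, if_true, fun i => (he0i i).symm, if_false, smul_eq_mul, mul_one,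
          Finset.sum_const, Finset.card_univ, Fintype.card_fin]
        obtain ⟨s, hs⟩ : ∃ s, q = A.count e0 + s := ⟨q - A.count e0, by omega⟩
        rw [show q - A.count e0 = s by omega]
        rw [hs]
        ring
      rw [hwt]; exact hrq
    · intro x hx
      exact hVo x (Multiset.mem_of_mem_nsmul hx)

end Patterns
section Assembly

set_option linter.unusedSectionVars false

open Multiset

variable {G : Type*} [AddCommGroup G] [Fintype G]

theorem exists_indep {r : ℕ} (hr : 0 < r) (n : Fin r → ℕ) (hn : ∀ i, 1 < n i)
    (hdvd : ∀ i j : Fin r, i ≤ j → n i ∣ n j) (φ : G ≃+ (∀ i : Fin r, ZMod (n i))) :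
    ∃ e : Fin r → G, (∀ i, n ⟨0, hr⟩ • e i = 0) ∧
      ∀ c : Fin r → ℕ, ∑ i, c i • e i = 0 → ∀ i, n ⟨0, hr⟩ ∣ c i := by
  have h0 : ∀ i, n ⟨0, hr⟩ ∣ n i := fun i => hdvd _ _ (Fin.mk_le_of_le_val (Nat.zero_le _))
  refine ⟨fun i => φ.symm (Pi.single i ((n i / n ⟨0, hr⟩ : ℕ) : ZMod (n i))), fun i => ?_,
    fun c hc i => ?_⟩
  · beta_reduce
    rw [← _root_.map_nsmul, ← Pi.single_smul, nsmul_eq_mul, ← Nat.cast_mul, Nat.mul_div_cancel' (h0 i)]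
    simp
  · have h1 := congrArg (fun g => φ g i) hc
    simp only [map_sum, _root_.map_nsmul, AddEquiv.apply_symm_apply, _root_.map_zero, Finset.sum_apply,
      Pi.smul_apply, Pi.zero_apply] at h1
    rw [Finset.sum_eq_single i (fun j _ hj => by rw [Pi.single_eq_of_ne hj.symm, smul_zero])
      (by simp), Pi.single_eq_same, nsmul_eq_mul, ← Nat.cast_mul, ZMod.natCast_eq_zero_iff] at h1
    obtain ⟨t, ht⟩ := h0 i
    have hn0 : 0 < n ⟨0, hr⟩ := lt_trans Nat.zero_lt_one (hn _)
    have hni := hn i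
    have htp : 0 < t := by
      rcases Nat.eq_zero_or_pos t with h | h
      · rw [h] at ht; omega
      · exact h
    rw [ht, Nat.mul_div_cancel_left _ hn0] at h1
    exact Nat.dvd_of_mul_dvd_mul_right htp h1

theorem exists_surj {r : ℕ} (n : Fin r → ℕ) (φ : G ≃+ (∀ i : Fin r, ZMod (n i))) :
    ∃ f : (Fin r → ℤ) →ₗ[ℤ] G, Function.Surjective f := by
  let g : (Fin r → ℤ) →+ (∀ i : Fin r, ZMod (n i)) :=
    { toFun := fun v i => (v i : ZMod (n i))
      map_zero' := by funext i; simp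
      map_add' := by intro v w; funext i; simp }
  refine ⟨(φ.symm.toAddMonoidHom.comp g).toIntLinearMap, fun x => ?_⟩
  choose v hv using fun i => ZMod.intCast_surjective (n := n i) (φ x i)
  refine ⟨v, ?_⟩
  have : g v = φ x := by funext i; exact hv i
  change φ.symm (g v) = x
  rw [this, AddEquiv.symm_apply_apply]

theorem exponent_le {r : ℕ} (hr : 0 < r) (n : Fin r → ℕ) (hn : ∀ i, 1 < n i)
    (hdvd : ∀ i j : Fin r, i ≤ j → n i ∣ n j) (φ : G ≃+ (∀ i : Fin r, ZMod (n i))) :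
    AddMonoid.exponent G ≤ n ⟨r - 1, by omega⟩ := by
  refine Nat.le_of_dvd (lt_trans Nat.zero_lt_one (hn _)) ?_
  refine AddMonoid.exponent_dvd_of_forall_nsmul_eq_zero fun g => ?_
  apply φ.injective
  rw [_root_.map_nsmul, _root_.map_zero]
  funext i
  rw [Pi.smul_apply, Pi.zero_apply, nsmul_eq_mul,
    (ZMod.natCast_eq_zero_iff _ _).2 (hdvd i ⟨r - 1, by omega⟩ (by
      rw [Fin.le_def]; have := i.2; simp; omega)), zero_mul]

theorem lemmaX {r : ℕ} (f : (Fin r → ℤ) →ₗ[ℤ] G) (hf : Function.Surjective f)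
    (hE : AddMonoid.exponent G ≤ r + 1) {G0 : Finset G} {d : ℕ} (hd : Cong d G0) (hrd : r ≤ d) :
    ∀ A, Atm A → Over G0 A → kap A = AddMonoid.exponent G := by
  have h1 : ∀ A, Atm A → Over G0 A → AddMonoid.exponent G ≤ kap A := by
    intro A hA hAo
    by_contra h
    have h2 := lemmaD hd hA hAo (not_le.1 h)
    have h3 := card_le_kap A
    omega
  intro A hA hAo
  by_contra h
  have := lemmaL f hf hd h1 ⟨A, hA, hAo, h⟩
  omega

theorem lemmaY {r' r : ℕ} (f : (Fin r' → ℤ) →ₗ[ℤ] G) (hf : Function.Surjective f)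
    (hE : AddMonoid.exponent G ≤ r + 1) (hE2 : 2 ≤ AddMonoid.exponent G) (hr : r' < r)
    {G0 : Finset G} (hd : Cong (r - 1) G0) :
    ∀ A, Atm A → Over G0 A → 2 ≤ kap A ∧ kap A ≤ AddMonoid.exponent G := by
  intro A hA hAo
  constructor
  · by_contra h
    have h2 := lemmaD hd hA hAo (by omega)
    have h3 := card_le_kap A
    omega
  by_contra h
  rw [not_le] at h
  have hd1 : Cong (r - 1) A.toFinset :=
    cong_mono (fun g hg => hAo g (Multiset.mem_toFinset.1 hg)) hd
  by_cases h1 : ∀ B, Atm B → Over A.toFinset B → AddMonoid.exponent G ≤ kap B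
  · have := lemmaL f hf hd1 h1 ⟨A, hA, fun g hg => Multiset.mem_toFinset.2 hg, h.ne'⟩
    omega
  push Not at h1
  obtain ⟨B, hB, hBo, hBk⟩ := h1
  have h2 := lemmaD hd1 hB hBo hBk
  have h3 := card_le_kap B
  have h4 : B.card = 2 := by omega
  obtain ⟨a, b, rfl⟩ := Multiset.card_eq_two.1 h4
  have hs : a + b = 0 := by simpa using hB.2.1
  by_cases hab : a = b
  · subst hab
    have h5 : addOrderOf a ≤ 2 := Nat.le_of_dvd (by norm_num)
      (addOrderOf_dvd_of_nsmul_eq_zero (by rw [two_nsmul]; exact hs))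
    have h6 := atm_eq_ord hB (x := a) (by simpa using h5)
    rw [h6, kap_ord] at hBk
    exact lt_irrefl _ hBk
  · have hle : ({a, b} : Multiset G) ≤ A := by
      rw [Multiset.le_iff_subset (by simp [hab])]
      intro x hx
      exact Multiset.mem_toFinset.1 (hBo x hx)
    have := atm_of_le hA hle hB.1 hB.2.1
    rw [this] at h
    omega

end Assembly

/-- If `G ≅ C_{n₁} ⊕ … ⊕ C_{n_r}` with `1 < n₁ ∣ … ∣ n_r`,
`D(G) ≥ 4`, `𝓛(G) = 𝓛(G')`, `r ≥ n_r − 1` and `n₁ ≠ 2`, then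
`r(G) = r(G')` and `r(G') ≥ exp(G') − 1`. -/
theorem stmt2 {G G' : Type*} [AddCommGroup G] [Fintype G] [AddCommGroup G'] [Fintype G']
    (r : ℕ) (hr : 0 < r) (n : Fin r → ℕ) (hn : ∀ i, 1 < n i)
    (hdvd : ∀ i j : Fin r, i ≤ j → n i ∣ n j)
    (hG : Nonempty (G ≃+ (∀ i : Fin r, ZMod (n i))))
    (r' : ℕ) (hr' : 0 < r') (n' : Fin r' → ℕ) (hn' : ∀ i, 1 < n' i)
    (hdvd' : ∀ i j : Fin r', i ≤ j → n' i ∣ n' j)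
    (hG' : Nonempty (G' ≃+ (∀ i : Fin r', ZMod (n' i))))
    (hD : 4 ≤ davenport G)
    (hL : systemL (Set.univ : Set G) = systemL (Set.univ : Set G'))
    (hcond : n ⟨r - 1, by omega⟩ - 1 ≤ r) (hne2 : n ⟨0, hr⟩ ≠ 2) :
    r = r' ∧ AddMonoid.exponent G' - 1 ≤ r' := by
  obtain ⟨φ⟩ := hG
  obtain ⟨φ'⟩ := hG'
  obtain ⟨e, he, hind⟩ := exists_indep hr n hn hdvd φ
  obtain ⟨e', he', hind'⟩ := exists_indep hr' n' hn' hdvd' φ'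
  obtain ⟨f, hf⟩ := exists_surj n φ
  obtain ⟨f', hf'⟩ := exists_surj n' φ'
  have hEG := exponent_le hr n hn hdvd φ
  have hq := hn ⟨0, hr⟩
  have hq' := hn' ⟨0, hr'⟩
  have hlast : n ⟨0, hr⟩ ≤ n ⟨r - 1, by omega⟩ :=
    Nat.le_of_dvd (lt_trans Nat.zero_lt_one (hn _))
      (hdvd _ _ (Fin.mk_le_of_le_val (Nat.zero_le _)))
  generalize n ⟨0, hr⟩ = q at *
  generalize n' ⟨0, hr'⟩ = q' at *
  have hE : AddMonoid.exponent G ≤ r + 1 := by omega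
  have hr2 : 2 ≤ r := by omega
  have hEpos : 0 < AddMonoid.exponent G := exp_pos
  have hm2 : 2 ≤ AddMonoid.exponent G' := by
    have h1 := hind' (fun _ => AddMonoid.exponent G')
      (Finset.sum_eq_zero fun i _ => AddMonoid.exponent_nsmul_eq_zero _) ⟨0, hr'⟩
    have := Nat.le_of_dvd exp_pos h1
    omega
  -- the exponent of the second group is at most r + 1
  have hm : AddMonoid.exponent G' ≤ r + 1 := by
    by_contra hcon
    obtain ⟨g, hg⟩ := AddMonoid.exists_addOrderOf_eq_exponent
      (AddMonoid.ExponentExists.of_finite (G := G'))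
    have hpat := patternA hg (by omega)
    rw [← hL] at hpat
    obtain ⟨G0, hc, hel⟩ := transfer hpat
    have hX := lemmaX f hf hE hc (by omega)
    have h1 := hel _ _ fun A hA hAo => ⟨(hX A hA hAo).ge, (hX A hA hAo).le⟩
    have := Nat.le_of_mul_le_mul_left h1 hEpos
    omega
  have hrr : r' ≤ r := by
    by_contra hcon
    have hpat := patternB (by omega) (by omega) e' he' hind'
    rw [← hL] at hpat
    obtain ⟨G0, hc, hel⟩ := transfer hpat
    have hX := lemmaX f hf hE hc (by omega)
    have h1 := hel _ _ fun A hA hAo => ⟨(hX A hA hAo).ge, (hX A hA hAo).le⟩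
    have h2 := Nat.le_of_mul_le_mul_left h1 hEpos
    obtain ⟨a, rfl⟩ : ∃ a, r' = a + 2 := ⟨r' - 2, by omega⟩
    obtain ⟨b, rfl⟩ : ∃ b, q' = b + 2 := ⟨q' - 2, by omega⟩
    have : b + 2 - 1 = b + 1 := by omega
    rw [this] at h2
    nlinarith [Nat.zero_le (a * b)]
  have hrr' : r ≤ r' := by
    by_contra hcon
    have hpat := patternB hr2 (by omega) e he hind
    rw [hL] at hpat
    obtain ⟨G0, hc, hel⟩ := transfer hpat
    have hY := lemmaY f' hf' hm hm2 (by omega) hc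
    have h1 := hel _ _ hY
    have h2 := Nat.mul_le_mul_right q hm
    obtain ⟨a, rfl⟩ : ∃ a, r = a + 2 := ⟨r - 2, by omega⟩
    obtain ⟨b, rfl⟩ : ∃ b, q = b + 3 := ⟨q - 3, by omega⟩
    have : b + 3 - 1 = b + 2 := by omega
    rw [this] at h1
    nlinarith [Nat.zero_le (a * b)]
  omega
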